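/- arXiv:0711.1936 — 4 statements merged into one kernel-verified Lean document; each statement's English description precedes it below -/
import Mathlib

section
/- Every linear subspace V of the space of d1×d2 complex matrices with dim V > (d1−k)(d2−k) contains a nonzero matrix of rank at most k. -/
open Matrix

namespace MvPolynomial

theorem homogeneousComponent_succ_mul_of_isHomogeneous_one {σ R : Type*} [CommSemiring R]
    (a : MvPolynomial σ R) {l : MvPolynomial σ R} (hl : l.IsHomogeneous 1) (n : ℕ) :
    homogeneousComponent (n + 1) (a * l) = homogeneousComponent n a * l := by
  let := gradedAlgebra (σ := σ) (R := R)
  have := DirectSum.coe_decompose_mul_of_right_mem_of_le (homogeneousSubmodule σ R)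
    (n := n + 1) (i := 1) (a := a) (b := l) hl (by omega)
  rw [Nat.add_sub_cancel] at this
  rw [← decomposition.decompose'_apply, ← decomposition.decompose'_apply]
  exact this

variable {σ K : Type*} [Field K] [Finite σ]

/-- If a homogeneous ideal `I` and the linear forms `L i` generate an ideal containing a power of the
ideal of variables, then `MvPolynomial σ K ⧸ I` is finite over the subalgebra generated by the
images of the `L i`. -/
theorem finite_quotient_adjoin_of_pow_idealOfVars_le {ι : Type*} [Finite ι]
    {I : Ideal (MvPolynomial σ K)} (hI : ∀ f ∈ I, ∀ n, homogeneousComponent n f ∈ I)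
    {L : ι → MvPolynomial σ K} (hL : ∀ i, (L i).IsHomogeneous 1) {m : ℕ}
    (hm : idealOfVars σ K ^ m ≤ I ⊔ Ideal.span (Set.range L)) :
    Module.Finite (Algebra.adjoin K (Set.range fun i => Ideal.Quotient.mk I (L i)))
      (MvPolynomial σ K ⧸ I) := by
  cases nonempty_fintype ι
  set S := Algebra.adjoin K (Set.range fun i => Ideal.Quotient.mk I (L i))
  let T : Set (σ →₀ ℕ) := {d | d.degree ≤ m}
  let N : Submodule S (MvPolynomial σ K ⧸ I) :=
    Submodule.span S ((fun d => Ideal.Quotient.mk I (monomial d 1)) '' T)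
  have hlow : ∀ n ≤ m, ∀ f : MvPolynomial σ K, f.IsHomogeneous n → Ideal.Quotient.mk I f ∈ N := by
    intro n hn f hf
    rw [f.as_sum, map_sum]
    refine Submodule.sum_mem _ fun d hd => ?_
    have hd' : d ∈ T := by
      have := hf.degree_eq_sum_deg_support hd
      exact this.symm.le.trans hn
    rw [← mul_one (coeff d f), ← C_mul_monomial, map_mul]
    exact N.smul_mem ⟨_, S.algebraMap_mem (coeff d f)⟩ (Submodule.subset_span ⟨d, hd', rfl⟩)
  have hN : ∀ n, ∀ f : MvPolynomial σ K, f.IsHomogeneous n → Ideal.Quotient.mk I f ∈ N := by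
    intro n
    induction n with
    | zero => exact hlow 0 m.zero_le
    | succ n ih =>
      intro f hf
      rcases le_or_gt (n + 1) m with hn | hn
      · exact hlow _ hn f hf
      have hfm : f ∈ idealOfVars σ K ^ m := by
        rw [mem_pow_idealOfVars_iff]
        intro d hd
        have := hf.degree_eq_sum_deg_support hd
        exact hn.le.trans this.le
      obtain ⟨g, hg, h, hh, rfl⟩ := Submodule.mem_sup.1 (hm hfm)
      obtain ⟨a, rfl⟩ := (Submodule.mem_span_range_iff_exists_fun _).1 hh
      rw [← homogeneousComponent_eq_self hf, map_add, map_add,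
        Ideal.Quotient.eq_zero_iff_mem.2 (hI g hg _), zero_add, map_sum, map_sum]
      refine Submodule.sum_mem _ fun i _ => ?_
      rw [smul_eq_mul, homogeneousComponent_succ_mul_of_isHomogeneous_one _ (hL i), map_mul,
        mul_comm]
      exact N.smul_mem ⟨_, Algebra.subset_adjoin ⟨i, rfl⟩⟩
        (ih _ (homogeneousComponent_isHomogeneous n (a i)))
  have hTop : N = ⊤ := by
    refine eq_top_iff.2 fun x _ => ?_
    obtain ⟨f, rfl⟩ := Ideal.Quotient.mk_surjective x
    rw [← sum_homogeneousComponent f, map_sum]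
    exact N.sum_mem fun n _ => hN n _ (homogeneousComponent_isHomogeneous n f)
  exact ⟨Submodule.fg_def.2 ⟨_, (Finsupp.finite_of_degree_le m).image _, hTop⟩⟩

/-- Fewer linear forms than algebraically independent elements of the homogeneous coordinate ring
have a common nontrivial zero on the cone defined by a homogeneous prime ideal. -/
theorem exists_ne_zero_mem_zeroLocus_of_card_lt [IsAlgClosed K] {ι τ : Type*} [Finite ι] [Finite τ]
    {I : Ideal (MvPolynomial σ K)} [I.IsPrime]
    (hI : ∀ f ∈ I, ∀ n, homogeneousComponent n f ∈ I)
    {L : ι → MvPolynomial σ K} (hL : ∀ i, (L i).IsHomogeneous 1)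
    {y : τ → MvPolynomial σ K ⧸ I} (hy : AlgebraicIndependent K y)
    (hcard : Nat.card ι < Nat.card τ) :
    ∃ x ∈ zeroLocus K I, x ≠ 0 ∧ ∀ i, eval x (L i) = 0 := by
  by_contra! H
  have hrad : idealOfVars σ K ≤ (I ⊔ Ideal.span (Set.range L)).radical := by
    rw [← vanishingIdeal_zeroLocus_eq_radical (K := K), Ideal.span_le]
    rintro _ ⟨j, rfl⟩ x hx
    have hx0 : x = 0 := by
      by_contra hne
      obtain ⟨i, hi⟩ := H x (zeroLocus_anti_mono le_sup_left hx) hne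
      apply hi
      have := hx (L i) (Ideal.mem_sup_right (Ideal.subset_span ⟨i, rfl⟩))
      simpa [aeval_eq_eval] using this
    simp [hx0]
  obtain ⟨m, hm⟩ := Ideal.exists_pow_le_of_le_radical_of_fg hrad (idealOfVars_fg σ K)
  have := finite_quotient_adjoin_of_pow_idealOfVars_le hI hL hm
  have alg : Algebra.IsAlgebraic (Algebra.adjoin K (Set.range fun i => Ideal.Quotient.mk I (L i)))
    (MvPolynomial σ K ⧸ I) := inferInstance
  have h1 := Algebra.IsAlgebraic.trdeg_le_cardinalMk K
    (Set.range fun i => Ideal.Quotient.mk I (L i))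
  have h2 := hy.lift_cardinalMk_le_trdeg
  have h3 := h2.trans (Cardinal.lift_le.2 h1)
  have h4 : Nat.card τ ≤ Nat.card (Set.range fun i => Ideal.Quotient.mk I (L i)) := by
    have := Cardinal.toNat_le_toNat h3 (by simp)
    simpa [Cardinal.toNat_lift, Nat.card] using this
  have h5 := Finite.card_range_le fun i => Ideal.Quotient.mk I (L i)
  omega

end MvPolynomial

section LowRank

open MvPolynomial

variable (K : Type*) [Field K] (m n : Type*) (k : ℕ)

/-- The ideal of relations among the entries of a product of a generic `m × k` matrix and a generic
`k × n` matrix. -/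
noncomputable def lowRankIdeal : Ideal (MvPolynomial (m × n) K) :=
  RingHom.ker (aeval fun p : m × n => ∑ r : Fin k,
    (X (.inl (p.1, r)) * X (.inr (r, p.2)) : MvPolynomial (m × Fin k ⊕ Fin k × n) K))

instance : (lowRankIdeal K m n k).IsPrime := RingHom.ker_isPrime _

variable {K m n k}

theorem mem_lowRankIdeal_iff [Infinite K] {f : MvPolynomial (m × n) K} :
    f ∈ lowRankIdeal K m n k ↔ ∀ (U : Matrix m (Fin k) K) (W : Matrix (Fin k) n K),
      eval (fun p => (U * W) p.1 p.2) f = 0 := by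
  have key (x : m × Fin k ⊕ Fin k × n → K) :
      eval x (aeval (fun p : m × n => ∑ r : Fin k,
        (X (.inl (p.1, r)) * X (.inr (r, p.2)) : MvPolynomial (m × Fin k ⊕ Fin k × n) K)) f) =
      eval (fun p => ∑ r : Fin k, x (.inl (p.1, r)) * x (.inr (r, p.2))) f := by
    rw [← coe_aeval_eq_eval, ← coe_aeval_eq_eval]
    simp only [RingHom.coe_coe]
    rw [← AlgHom.comp_apply, comp_aeval]
    simp
  rw [lowRankIdeal, RingHom.mem_ker]
  constructor
  · intro h U W
    have := key (Sum.elim (fun p => U p.1 p.2) (fun p => W p.1 p.2))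
    rw [h, map_zero] at this
    simpa [Matrix.mul_apply] using this.symm
  · intro h
    refine MvPolynomial.funext fun x => ?_
    rw [key, map_zero]
    exact h (.of fun i r => x (.inl (i, r))) (.of fun r j => x (.inr (r, j)))

theorem MvPolynomial.IsHomogeneous.eval_smul {σ R : Type*} [CommSemiring R] {p : MvPolynomial σ R}
    {d : ℕ} (hp : p.IsHomogeneous d) (t : R) (x : σ → R) :
    eval (t • x) p = t ^ d * eval x p := by
  rw [eval_eq, eval_eq, Finset.mul_sum]
  refine Finset.sum_congr rfl fun e he => ?_
  have hd : ∑ i ∈ e.support, e i = d := (hp.degree_eq_sum_deg_support he).symm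
  simp_rw [Pi.smul_apply, smul_eq_mul, mul_pow]
  rw [Finset.prod_mul_distrib, Finset.prod_pow_eq_pow_sum, hd, mul_left_comm]

theorem homogeneousComponent_mem_lowRankIdeal [Infinite K] {f : MvPolynomial (m × n) K}
    (hf : f ∈ lowRankIdeal K m n k) (d : ℕ) : homogeneousComponent d f ∈ lowRankIdeal K m n k := by
  rw [mem_lowRankIdeal_iff] at hf ⊢
  intro U W
  set x : m × n → K := fun p => (U * W) p.1 p.2 with hx
  let q : Polynomial K := ∑ i ∈ Finset.range (f.totalDegree + 1),
    Polynomial.monomial i (eval x (homogeneousComponent i f))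
  have hq : q = 0 := by
    refine Polynomial.funext fun t => ?_
    have := hf (t • U) W
    have hx' : (fun p : m × n => (t • U * W) p.1 p.2) = t • x := by
      ext p; simp [hx]
    rw [hx', ← sum_homogeneousComponent f, map_sum] at this
    rw [Polynomial.eval_zero, Polynomial.eval_finsetSum, ← this]
    refine Finset.sum_congr rfl fun i _ => ?_
    rw [Polynomial.eval_monomial, (homogeneousComponent_isHomogeneous i f).eval_smul, mul_comm]
  by_cases hd : f.totalDegree < d
  · rw [homogeneousComponent_eq_zero _ _ hd, map_zero]
  · have := congrArg (Polynomial.coeff · d) hq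
    simpa [q, Polynomial.finsetSum_coeff, Polynomial.coeff_monomial, Nat.lt_succ_iff,
      not_lt.1 hd] using this

variable [Fintype m] [Fintype n]

theorem Matrix.exists_mul_mul_eq_one_of_le_rank {r : ℕ} (A : Matrix m n K) (hr : r ≤ A.rank) :
    ∃ (P : Matrix (Fin r) m K) (Q : Matrix n (Fin r) K), P * A * Q = 1 := by
  classical
  obtain ⟨v, hv⟩ := exists_linearIndependent_of_le_finrank (R := K)
    (M := LinearMap.range A.mulVecLin) hr
  choose q hq using fun j => (v j).2
  let Q : Matrix n (Fin r) K := .of fun i j => q j i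
  have hcol : (A * Q).col = fun j => (v j : m → K) := by
    ext j i
    rw [← hq j]
    rfl
  have hli : LinearIndependent K (A * Q).col := by
    rw [hcol]
    exact hv.map' (Submodule.subtype _) (Submodule.ker_subtype _)
  obtain ⟨g, hg⟩ := LinearMap.exists_leftInverse_of_injective (Matrix.toLin' (A * Q))
    (LinearMap.ker_eq_bot.2 (Matrix.mulVec_injective_iff.2 hli))
  refine ⟨LinearMap.toMatrix' g, Q, ?_⟩
  rw [Matrix.mul_assoc, ← LinearMap.toMatrix'_toLin' (A * Q), ← LinearMap.toMatrix'_comp, hg,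
    LinearMap.toMatrix'_id]

theorem rank_le_of_mem_zeroLocus_lowRankIdeal [Infinite K] {x : m × n → K}
    (hx : x ∈ zeroLocus K (lowRankIdeal K m n k)) :
    (Matrix.of fun i j => x (i, j)).rank ≤ k := by
  by_contra! h
  obtain ⟨P, Q, hPQ⟩ := Matrix.exists_mul_mul_eq_one_of_le_rank _ (Nat.succ_le_of_lt h)
  let G : Matrix (Fin (k + 1)) (Fin (k + 1)) (MvPolynomial (m × n) K) :=
    (P.map C : Matrix (Fin (k + 1)) m (MvPolynomial (m × n) K)) * mvPolynomialX m n K *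
      (Q.map C : Matrix n (Fin (k + 1)) (MvPolynomial (m × n) K))
  let F : MvPolynomial (m × n) K := G.det
  have hF (y : m × n → K) : eval y F = (P * (Matrix.of fun i j => y (i, j)) * Q).det := by
    rw [RingHom.map_det, RingHom.mapMatrix_apply, Matrix.map_mul, Matrix.map_mul]
    congr 3
    · ext; simp
    · ext; simp
    · ext; simp
  have hmem : F ∈ lowRankIdeal K m n k := by
    rw [mem_lowRankIdeal_iff]
    intro U W
    rw [hF]
    by_contra hne
    have h1 := Matrix.rank_of_det_ne_zero hne
    have h2 : P * (Matrix.of fun i j => (U * W) i j) * Q = (P * U) * (W * Q) := by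
      change P * (U * W) * Q = _
      simp only [Matrix.mul_assoc]
    rw [h2] at h1
    have h3 := (Matrix.rank_mul_le_left (P * U) (W * Q)).trans (P * U).rank_le_width
    rw [h1, Fintype.card_fin] at h3
    omega
  have := hx F hmem
  rw [← RingHom.coe_coe, coe_aeval_eq_eval, hF, hPQ, Matrix.det_one] at this
  exact one_ne_zero this

theorem algebraicIndependent_lowRankIdeal [Infinite K] {d1 d2 : ℕ} (h1 : k ≤ d1) (h2 : k ≤ d2) :
    AlgebraicIndependent K
      fun p : {p : Fin d1 × Fin d2 // (p.1 : ℕ) < k ∨ (p.2 : ℕ) < k} =>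
        Ideal.Quotient.mk (lowRankIdeal K (Fin d1) (Fin d2) k) (X p.1) := by
  rw [algebraicIndependent_iff]
  intro f hf
  let I := lowRankIdeal K (Fin d1) (Fin d2) k
  have hf' : rename Subtype.val f ∈ I := by
    rw [← Ideal.Quotient.eq_zero_iff_mem, ← hf]
    change (Ideal.Quotient.mkₐ K I) _ = _
    rw [← AlgHom.comp_apply]
    congr 1
    ext p
    simp [I]
  rw [mem_lowRankIdeal_iff] at hf'
  simp only [eval_rename] at hf'
  let Y : Matrix (Fin k) (Fin k)
      (MvPolynomial {p : Fin d1 × Fin d2 // (p.1 : ℕ) < k ∨ (p.2 : ℕ) < k} K) :=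
    .of fun i j => X ⟨(i.castLE h1, j.castLE h2), Or.inl i.2⟩
  have hY (x) : eval x Y.det = (Matrix.of fun i j : Fin k =>
      x ⟨(i.castLE h1, j.castLE h2), Or.inl i.2⟩).det := by
    rw [RingHom.map_det, RingHom.mapMatrix_apply]
    congr 1
    ext; simp [Y]
  have hYne : Y.det ≠ 0 := by
    intro h0
    have := hY fun p => if (p.1.1 : ℕ) = p.1.2 then 1 else 0
    rw [h0, map_zero] at this
    refine zero_ne_one (this.trans ?_)
    rw [← Matrix.det_one (n := Fin k)]
    congr 1
    ext i j
    simp [Matrix.one_apply, Fin.ext_iff]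
  refine (mul_eq_zero.1 (?_ : Y.det * f = 0)).resolve_left hYne
  refine MvPolynomial.funext fun x => ?_
  rw [map_mul, map_zero, hY]
  set B : Matrix (Fin k) (Fin k) K := Matrix.of fun i j : Fin k =>
      x ⟨(i.castLE h1, j.castLE h2), Or.inl i.2⟩ with hB
  by_cases hdet : B.det = 0
  · rw [hdet, zero_mul]
  have hunit : IsUnit B.det := isUnit_iff_ne_zero.2 hdet
  let D : Matrix (Fin d1) (Fin k) K := .of fun i j => x ⟨(i, j.castLE h2), Or.inr j.2⟩
  let W : Matrix (Fin k) (Fin d2) K := .of fun i j => x ⟨(i.castLE h1, j), Or.inl i.2⟩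
  have hUW : (fun p : Fin d1 × Fin d2 => (D * B⁻¹ * W) p.1 p.2) ∘ Subtype.val = x := by
    funext ⟨⟨i, j⟩, hij⟩
    change (D * B⁻¹ * W) i j = _
    rcases hij with hi | hj
    · have hD : D.submatrix (Fin.castLE h1) id = B := rfl
      have := congrFun (congrFun (Matrix.submatrix_mul (D * B⁻¹) W (Fin.castLE h1) id id
        Function.bijective_id) ⟨i, hi⟩) j
      rw [Matrix.submatrix_mul D B⁻¹ (Fin.castLE h1) id id Function.bijective_id, hD,
        Matrix.submatrix_id_id, Matrix.submatrix_id_id, Matrix.mul_nonsing_inv _ hunit,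
        Matrix.one_mul] at this
      exact this
    · have hW : W.submatrix id (Fin.castLE h2) = B := rfl
      have := congrFun (congrFun (Matrix.submatrix_mul (D * B⁻¹) W id id (Fin.castLE h2)
        Function.bijective_id) i) ⟨j, hj⟩
      rw [hW, Matrix.submatrix_id_id, Matrix.nonsing_inv_mul_cancel_right _ _ hunit] at this
      exact this
  have := hf' (D * B⁻¹) W
  rw [hUW] at this
  rw [this, mul_zero]

theorem card_lt_or_lt_add (d1 d2 k : ℕ) :
    Nat.card {p : Fin d1 × Fin d2 // (p.1 : ℕ) < k ∨ (p.2 : ℕ) < k} + (d1 - k) * (d2 - k) =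
      d1 * d2 := by
  have h (d : ℕ) : Fintype.card {i : Fin d // k ≤ (i : ℕ)} = d - k := by
    have := Fintype.card_subtype_compl fun i : Fin d => (i : ℕ) < k
    rw [Fintype.card_subtype, Fintype.card_subtype, Fin.card_filter_val_lt,
      Fintype.card_fin] at this
    simp only [not_lt] at this
    rw [Fintype.card_subtype]
    omega
  have e : {p : Fin d1 × Fin d2 // ¬ ((p.1 : ℕ) < k ∨ (p.2 : ℕ) < k)} ≃
      {i : Fin d1 // k ≤ (i : ℕ)} × {j : Fin d2 // k ≤ (j : ℕ)} :=
    (Equiv.subtypeEquivRight fun p => by simp).trans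
      (Equiv.subtypeProdEquivProd (p := fun i : Fin d1 => k ≤ (i : ℕ))
        (q := fun j : Fin d2 => k ≤ (j : ℕ)))
  have := Fintype.card_congr e
  rw [Fintype.card_prod, h, h] at this
  rw [← this, Nat.card_eq_fintype_card, Fintype.card_subtype_compl,
    Nat.add_sub_cancel' (Fintype.card_subtype_le _)]
  simp

end LowRank


/-- Every linear subspace `V` of the space of `d1 × d2` complex matrices with
`dim V > (d1 - k) * (d2 - k)` contains a nonzero matrix of rank at most `k`. -/
theorem subspace_dim_gt_contains_low_rank (d1 d2 k : ℕ) (hd1 : 0 < d1) (hd : d1 ≤ d2)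
    (hk1 : 1 ≤ k) (hk : k ≤ d1)
    (V : Submodule ℂ (Matrix (Fin d1) (Fin d2) ℂ))
    (hV : (d1 - k) * (d2 - k) < Module.finrank ℂ V) :
    ∃ M ∈ V, M ≠ 0 ∧ M.rank ≤ k := by
  let b := Module.finBasis ℂ V.dualAnnihilator
  let L : Fin (Module.finrank ℂ V.dualAnnihilator) → MvPolynomial (Fin d1 × Fin d2) ℂ := fun i =>
    ∑ p, MvPolynomial.C ((b i).1 (Matrix.single p.1 p.2 1)) * MvPolynomial.X p
  have hL (i) : (L i).IsHomogeneous 1 :=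
    .sum _ _ _ fun p _ => .C_mul (MvPolynomial.isHomogeneous_X _ _) _
  have hLeval (i) (x) : MvPolynomial.eval x (L i) = (b i).1 (Matrix.of fun i j => x (i, j)) := by
    rw [Matrix.matrix_eq_sum_single (Matrix.of fun i j => x (i, j))]
    simp only [L, map_sum, map_mul, MvPolynomial.eval_C, MvPolynomial.eval_X,
      Fintype.sum_prod_type, Matrix.of_apply]
    refine Finset.sum_congr rfl fun i' _ => Finset.sum_congr rfl fun j' _ => ?_
    rw [← mul_one (x (i', j')), ← smul_eq_mul (x (i', j')), ← Matrix.smul_single, map_smul]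
    simp [mul_comm]
  have hfin := Subspace.finrank_add_finrank_dualAnnihilator_eq V
  rw [Module.finrank_matrix] at hfin
  simp only [Fintype.card_fin, Module.finrank_self, mul_one] at hfin
  have hcard := card_lt_or_lt_add d1 d2 k
  obtain ⟨x, hx, hx0, hLx⟩ := MvPolynomial.exists_ne_zero_mem_zeroLocus_of_card_lt
    (fun f hf d => homogeneousComponent_mem_lowRankIdeal hf d) hL
    (algebraicIndependent_lowRankIdeal (K := ℂ) hk (hk.trans hd))
    (by rw [Nat.card_fin]; omega)
  refine ⟨Matrix.of fun i j => x (i, j), ?_, ?_, rank_le_of_mem_zeroLocus_lowRankIdeal hx⟩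
  · rw [← Subspace.dualAnnihilator_dualCoannihilator_eq (W := V), Submodule.mem_dualCoannihilator]
    intro φ hφ
    have := b.sum_repr ⟨φ, hφ⟩
    rw [← Subtype.coe_mk φ hφ, ← this, Submodule.coe_sum, LinearMap.sum_apply]
    refine Finset.sum_eq_zero fun i _ => ?_
    rw [Submodule.coe_smul, LinearMap.smul_apply, ← hLeval, hLx, smul_zero]
  · intro h0
    exact hx0 (funext fun p => congrFun (congrFun h0 p.1) p.2)
end

section
/- For any k-Schmidt witness W on ℂ^{d1} ⊗ ℂ^{d2} with d1 ≤ d2, the dimension of the negative eigenspace V_− satisfies 1 ≤ dim V_− ≤ (d1−k)(d2−k). -/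
open Matrix
open scoped ComplexOrder

/-- The coordinate matrix of a vector in `ℂ^{d1} ⊗ ℂ^{d2}`. -/
noncomputable def coordMat {d1 d2 : ℕ} (Ψ : Fin d1 × Fin d2 → ℂ) :
    Matrix (Fin d1) (Fin d2) ℂ :=
  Matrix.of fun i j => Ψ (i, j)

/-- The Schmidt rank of a vector: the rank of its coordinate matrix. -/
noncomputable def schmidtRank {d1 d2 : ℕ} (Ψ : Fin d1 × Fin d2 → ℂ) : ℕ :=
  (coordMat Ψ).rank

/-- A `k`-Schmidt witness: a Hermitian operator which is nonnegative on all vectors of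
Schmidt rank at most `k`, but has negative expectation on some density operator. -/
structure IsSchmidtWitness {d1 d2 : ℕ} (k : ℕ)
    (W : Matrix (Fin d1 × Fin d2) (Fin d1 × Fin d2) ℂ) : Prop where
  herm : W.IsHermitian
  pos : ∀ Ψ : Fin d1 × Fin d2 → ℂ, schmidtRank Ψ ≤ k → 0 ≤ (star Ψ ⬝ᵥ W.mulVec Ψ).re
  detects : ∃ ρ : Matrix (Fin d1 × Fin d2) (Fin d1 × Fin d2) ℂ,
    ρ.PosSemidef ∧ ρ.trace = 1 ∧ Complex.re (Matrix.trace (ρ * W)) < 0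


/-- The span of the eigenvectors of `W` corresponding to negative eigenvalues. -/
noncomputable def negSpace {d1 d2 : ℕ}
    (W : Matrix (Fin d1 × Fin d2) (Fin d1 × Fin d2) ℂ) :
    Submodule ℂ (Fin d1 × Fin d2 → ℂ) :=
  ⨆ (μ : ℝ) (_ : μ < 0), Module.End.eigenspace (Matrix.toLin' W) (μ : ℂ)

theorem Matrix.exists_linearIndependent_row_of_le_rank {F m n : Type*} [Field F] [Fintype m]
    [Fintype n] {r : ℕ} (N : Matrix m n F) (hr : r ≤ N.rank) :
    ∃ f : Fin r → m, LinearIndependent F (N.submatrix f id).row := by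
  obtain ⟨κ, a, ha, hspan, hli⟩ := exists_linearIndependent' F N.row
  have : Finite κ := Finite.of_injective a ha
  have := Fintype.ofFinite κ
  have hcard : Fintype.card κ = N.rank := by
    rw [N.rank_eq_finrank_span_row, ← hspan, linearIndependent_iff_card_eq_finrank_span.mp hli,
      Set.finrank]
  let e : Fin r ↪ κ := (Fin.castLEEmb (hr.trans hcard.ge)).trans (Fintype.equivFin κ).symm
  exact ⟨a ∘ e, hli.comp e e.injective⟩

theorem Matrix.exists_submatrix_det_ne_zero_of_le_rank {F m n : Type*} [Field F] [Fintype m]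
    [Fintype n] {r : ℕ} (N : Matrix m n F) (hr : r ≤ N.rank) :
    ∃ (f : Fin r → m) (g : Fin r → n), (N.submatrix f g).det ≠ 0 := by
  obtain ⟨f, hf⟩ := N.exists_linearIndependent_row_of_le_rank hr
  have hfr := hf.rank_matrix
  obtain ⟨g, hg⟩ := (N.submatrix f id)ᵀ.exists_linearIndependent_row_of_le_rank (r := r)
    (by rw [Matrix.rank_transpose, hfr, Fintype.card_fin])
  refine ⟨f, g, ?_⟩
  have : LinearIndependent F (N.submatrix f g)ᵀ.row := hg
  rw [Matrix.linearIndependent_rows_iff_isUnit, Matrix.isUnit_iff_isUnit_det,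
    Matrix.det_transpose] at this
  exact this.ne_zero

theorem Matrix.det_submatrix_eq_zero_of_rank_lt {F m n : Type*} [Field F] [Fintype m]
    [Fintype n] {r : ℕ} (N : Matrix m n F) (hr : N.rank < r) (f : Fin r → m) (g : Fin r → n) :
    (N.submatrix f g).det = 0 := by
  by_contra h
  have h1 := Matrix.rank_of_det_ne_zero h
  have h2 := Matrix.rank_submatrix_le N f g
  simp at h1
  omega

/-- A system of polynomial equations over an algebraically closed field that has a solution in
some nontrivial extension ring has a solution in the field. -/
theorem MvPolynomial.exists_point_of_ringHom {F σ R : Type*} [Field F] [IsAlgClosed F] [Finite σ]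
    [CommRing R] [Nontrivial R] (φ : MvPolynomial σ F →+* R) :
    ∃ z : σ → F, ∀ p, φ p = 0 → MvPolynomial.eval z p = 0 := by
  obtain ⟨I, hI, hle⟩ := Ideal.exists_le_maximal _ (RingHom.ker_ne_top φ)
  obtain ⟨z, rfl⟩ := (MvPolynomial.isMaximal_iff_eq_vanishingIdeal_singleton (K := F)).mp hI
  refine ⟨z, fun p hp => ?_⟩
  simpa [MvPolynomial.aeval_eq_eval] using
    (MvPolynomial.mem_vanishingIdeal_singleton_iff z p).mp (hle hp)

/-- If the linear forms `L` have no common nonzero zero among the matrices of rank at most `k`, then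
the entries of any matrix of rank at most `k` over a field extension are integral over the values
of these forms: otherwise a valuation subring containing these values misses an entry, and reducing
the matrix divided by its largest entry yields a common zero. -/
theorem Matrix.isIntegral_entry_of_forall_rank_le {F K m n κ : Type*} [Field F] [IsAlgClosed F]
    [Field K] [Algebra F K] [Fintype m] [Fintype n] {k : ℕ} (M : Matrix m n K)
    (hM : M.rank ≤ k) (L : κ → Matrix m n F)
    (hL : ∀ N : Matrix m n F, N.rank ≤ k → (∀ t, ∑ i, ∑ j, L t i j * N i j = 0) → N = 0)
    (i : m) (j : n) :
    IsIntegral (Algebra.adjoin F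
      (Set.range fun t => ∑ i, ∑ j, algebraMap F K (L t i j) * M i j)) (M i j) := by
  set l : κ → K := fun t => ∑ i, ∑ j, algebraMap F K (L t i j) * M i j with hl
  let s : Set K := Set.range (algebraMap F K) ∪ Set.range l
  suffices h : M i j ∈ (integralClosure (Subring.closure s) K).toSubring by
    have h' : IsIntegral (Subring.closure s) (M i j) := h
    have hle : Subring.closure s ≤ (Algebra.adjoin F (Set.range l)).toSubring := by
      rw [Subring.closure_le]
      rintro x (⟨a, rfl⟩ | hx)
      · exact Subalgebra.algebraMap_mem _ a
      · exact Algebra.subset_adjoin hx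
    exact h'.map_of_comp_eq (Subring.inclusion hle) (RingHom.id K) rfl
  rw [← iInf_valuationSubring_superset, Subring.mem_iInf]
  rintro ⟨V, hV⟩
  by_contra hij
  change M i j ∉ V at hij
  have hF : ∀ a, algebraMap F K a ∈ V := fun a => hV (Or.inl ⟨a, rfl⟩)
  have hlV : ∀ t, l t ∈ V := fun t => hV (Or.inr ⟨t, rfl⟩)
  obtain ⟨⟨p, q⟩, -, hmax⟩ := Finset.exists_max_image (Finset.univ : Finset (m × n))
    (fun x => V.valuation (M x.1 x.2)) ⟨(i, j), Finset.mem_univ _⟩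
  have hpq : 1 < V.valuation (M p q) := by
    refine lt_of_lt_of_le ?_ (hmax (i, j) (Finset.mem_univ _))
    rwa [← not_le, V.valuation_le_one_iff]
  have hpq0 : M p q ≠ 0 := by
    intro h
    simp [h] at hpq
  have hinv : V.valuation (M p q)⁻¹ < 1 := by
    rw [map_inv₀]
    exact inv_lt_one_of_one_lt₀ hpq
  have hY : ∀ i j, (M p q)⁻¹ * M i j ∈ V := by
    intro i j
    rw [← V.valuation_le_one_iff, map_mul, map_inv₀]
    exact inv_mul_le_one_of_le₀ (hmax (i, j) (Finset.mem_univ _)) zero_le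
  let c : F →+* V := (algebraMap F K).codRestrict V hF
  let ψ : MvPolynomial (m × n) F →+* V :=
    MvPolynomial.eval₂Hom c fun x => ⟨(M p q)⁻¹ * M x.1 x.2, hY x.1 x.2⟩
  have hψX : ∀ i j, (ψ (MvPolynomial.X (i, j)) : K) = (M p q)⁻¹ * M i j := by
    intro i j
    simp [ψ]
  have hψC : ∀ a, (ψ (MvPolynomial.C a) : K) = algebraMap F K a := by
    intro a
    simp [ψ, c]
  obtain ⟨z, hz⟩ := MvPolynomial.exists_point_of_ringHom ((IsLocalRing.residue V).comp ψ)
  let N : Matrix m n F := Matrix.of fun i j => z (i, j)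
  have hN1 : N p q = 1 := by
    have h1 : ψ (MvPolynomial.X (p, q) - 1) = 0 := by
      apply Subtype.ext
      simp [hψX, hpq0]
    have := hz (MvPolynomial.X (p, q) - 1) (by rw [RingHom.comp_apply, h1, map_zero])
    simpa [N, sub_eq_zero] using this
  have hNr : N.rank ≤ k := by
    by_contra! hlt
    obtain ⟨f, g, hfg⟩ := N.exists_submatrix_det_ne_zero_of_le_rank (Nat.succ_le_of_lt hlt)
    apply hfg
    let P : Matrix (Fin k.succ) (Fin k.succ) (MvPolynomial (m × n) F) :=
      Matrix.of fun a b => MvPolynomial.X (f a, g b)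
    have hP : ψ P.det = 0 := by
      apply V.subtype_injective
      rw [map_zero, RingHom.map_det, RingHom.map_det]
      have : V.subtype.mapMatrix (ψ.mapMatrix P) = (M p q)⁻¹ • M.submatrix f g := by
        ext a b
        simp [P, hψX]
      rw [this, Matrix.det_smul,
        M.det_submatrix_eq_zero_of_rank_lt (Nat.lt_succ_of_le hM), mul_zero]
    have := hz P.det (by rw [RingHom.comp_apply, hP, map_zero])
    rw [RingHom.map_det] at this
    rw [← this]
    congr 1
    ext a b
    simp [P, N]
  have hNL : ∀ t, ∑ i, ∑ j, L t i j * N i j = 0 := by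
    intro t
    let Q : MvPolynomial (m × n) F :=
      ∑ i, ∑ j, MvPolynomial.C (L t i j) * MvPolynomial.X (i, j)
    have hQ : (ψ Q : K) = (M p q)⁻¹ * l t := by
      have : V.subtype (ψ Q) = (M p q)⁻¹ * l t := by
        simp only [Q, hl, map_sum, map_mul, Finset.mul_sum, ValuationSubring.subtype_apply,
          hψX, hψC]
        refine Finset.sum_congr rfl fun i _ => Finset.sum_congr rfl fun j _ => by ring
      exact this
    have hmem : ψ Q ∈ IsLocalRing.maximalIdeal V := by
      rw [V.valuation_lt_one_iff, hQ, map_mul]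
      exact mul_lt_one_of_lt_of_le hinv ((V.valuation_le_one_iff _).mpr (hlV t))
    have := hz Q (by
      rw [RingHom.comp_apply]
      exact Ideal.Quotient.eq_zero_iff_mem.mpr hmem)
    simpa [Q, N] using this
  have := hL N hNr hNL
  rw [this] at hN1
  simp at hN1

/-- The generic matrix with prescribed first block row and block column, and of rank at most the
size of the top left block. -/
theorem Matrix.exists_generic_of_rank_le (F K a m n : Type*) [Field F] [Field K] [Fintype a]
    [DecidableEq a] [Fintype m] [Fintype n] [Algebra (MvPolynomial (a × a ⊕ a × n ⊕ m × a) F) K]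
    [IsFractionRing (MvPolynomial (a × a ⊕ a × n ⊕ m × a) F) K] :
    ∃ M : Matrix (a ⊕ m) (a ⊕ n) K,
      M.rank ≤ Fintype.card a ∧
      ∀ x : a × a ⊕ a × n ⊕ m × a, ∃ i j, M i j =
        algebraMap (MvPolynomial (a × a ⊕ a × n ⊕ m × a) F) K (MvPolynomial.X x) := by
  let S := MvPolynomial (a × a ⊕ a × n ⊕ m × a) F
  let X : a × a ⊕ a × n ⊕ m × a → K := fun x => algebraMap S K (MvPolynomial.X x)
  let A : Matrix a a K := Matrix.of fun i j => X (.inl (i, j))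
  let B : Matrix a n K := Matrix.of fun i j => X (.inr (.inl (i, j)))
  let C : Matrix m a K := Matrix.of fun i j => X (.inr (.inr (i, j)))
  have hA : A.det ≠ 0 := by
    let r : MvPolynomial (a × a) F →ₐ[F] S := MvPolynomial.rename Sum.inl
    have hr : Function.Injective ((algebraMap S K).comp r.toRingHom) :=
      (IsFractionRing.injective S K).comp (MvPolynomial.rename_injective _ Sum.inl_injective)
    have h := Matrix.det_mvPolynomialX_ne_zero a F
    have hAeq : A = ((algebraMap S K).comp r.toRingHom).mapMatrix
        (Matrix.mvPolynomialX a a F) := by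
      ext i j
      change _ = algebraMap S K (r (Matrix.mvPolynomialX a a F i j))
      rw [Matrix.mvPolynomialX_apply, MvPolynomial.rename_X]
      rfl
    rw [hAeq, ← RingHom.map_det]
    exact (map_ne_zero_iff _ hr).mpr h
  refine ⟨Matrix.fromBlocks A B C (C * A⁻¹ * B), ?_, ?_⟩
  · have hfac : Matrix.fromBlocks A B C (C * A⁻¹ * B) =
        Matrix.fromRows 1 (C * A⁻¹) * Matrix.fromCols A B := by
      rw [Matrix.fromRows_mul_fromCols, Matrix.one_mul, Matrix.one_mul,
        Matrix.mul_assoc C A⁻¹ A, Matrix.nonsing_inv_mul _ (Ne.isUnit hA), Matrix.mul_one]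
    rw [hfac]
    exact (Matrix.rank_mul_le_right _ _).trans (Matrix.rank_le_card_height _)
  · rintro (⟨i, j⟩ | ⟨i, j⟩ | ⟨i, j⟩)
    · exact ⟨.inl i, .inl j, rfl⟩
    · exact ⟨.inl i, .inr j, rfl⟩
    · exact ⟨.inr i, .inl j, rfl⟩

theorem MvPolynomial.card_le_card_of_isAlgebraic_X {F σ κ K : Type} [Field F] [Field K] [Fintype σ]
    [Fintype κ] [Algebra F K] [Algebra (MvPolynomial σ F) K]
    [IsScalarTower F (MvPolynomial σ F) K] [IsFractionRing (MvPolynomial σ F) K] (l : κ → K)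
    (hl : ∀ x : σ, IsAlgebraic (Algebra.adjoin F (Set.range l))
      (algebraMap (MvPolynomial σ F) K (MvPolynomial.X x))) :
    Fintype.card σ ≤ Fintype.card κ := by
  have hpoly : ∀ p : MvPolynomial σ F, IsAlgebraic (Algebra.adjoin F (Set.range l))
      (algebraMap (MvPolynomial σ F) K p) := by
    intro p
    induction p using MvPolynomial.induction_on with
    | C c =>
      rw [← MvPolynomial.algebraMap_eq, ← IsScalarTower.algebraMap_apply,
        IsScalarTower.algebraMap_apply F (Algebra.adjoin F (Set.range l)) K]
      exact isAlgebraic_algebraMap _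
    | add p q hp hq => rw [map_add]; exact hp.add hq
    | mul_X p x hp => rw [map_mul]; exact hp.mul (hl x)
  have : Algebra.IsAlgebraic (Algebra.adjoin F (Set.range l)) K := by
    refine ⟨fun y => ?_⟩
    obtain ⟨p, q, -, rfl⟩ := IsFractionRing.div_surjective (A := MvPolynomial σ F) y
    rw [div_eq_mul_inv]
    exact (hpoly p).mul (IsAlgebraic.inv_iff.mpr (hpoly q))
  have hind : AlgebraicIndependent F
      fun x : σ => algebraMap (MvPolynomial σ F) K (MvPolynomial.X x) :=
    (MvPolynomial.algebraicIndependent_X _ F).map' (f := IsScalarTower.toAlgHom F _ K)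
      (IsFractionRing.injective (MvPolynomial σ F) K)
  have hle := hind.cardinalMk_le_trdeg.trans
    ((Algebra.IsAlgebraic.trdeg_le_cardinalMk F (Set.range l)).trans Cardinal.mk_range_le)
  simpa only [Cardinal.mk_fintype, Nat.cast_le] using hle

/-- If finitely many linear forms have no common nonzero zero among the matrices of rank at most
`Fintype.card a`, there are at least as many forms as the dimension of that determinantal
variety. -/
theorem Matrix.card_le_card_of_forall_rank_le {F a m n κ : Type} [Field F] [IsAlgClosed F]
    [Fintype a] [Fintype m] [Fintype n] [Fintype κ] (L : κ → Matrix (a ⊕ m) (a ⊕ n) F)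
    (hL : ∀ N : Matrix (a ⊕ m) (a ⊕ n) F, N.rank ≤ Fintype.card a →
      (∀ t, ∑ i, ∑ j, L t i j * N i j = 0) → N = 0) :
    Fintype.card (a × a ⊕ a × n ⊕ m × a) ≤ Fintype.card κ := by
  classical
  obtain ⟨M, hM, hX⟩ := Matrix.exists_generic_of_rank_le F
    (FractionRing (MvPolynomial (a × a ⊕ a × n ⊕ m × a) F)) a m n
  have hint := M.isIntegral_entry_of_forall_rank_le hM L hL
  refine MvPolynomial.card_le_card_of_isAlgebraic_X (F := F)
    (fun t => ∑ i, ∑ j, algebraMap F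
      (FractionRing (MvPolynomial (a × a ⊕ a × n ⊕ m × a) F)) (L t i j) * M i j) fun x => ?_
  obtain ⟨i, j, hij⟩ := hX x
  rw [← hij]
  exact (hint i j).isAlgebraic

theorem Matrix.finrank_le_mul_of_forall_rank_le {F : Type} [Field F] [IsAlgClosed F]
    {d1 d2 k : ℕ} (hk1 : k ≤ d1) (hk2 : k ≤ d2) (V : Submodule F (Matrix (Fin d1) (Fin d2) F))
    (hV : ∀ N ∈ V, N.rank ≤ k → N = 0) :
    Module.finrank F V ≤ (d1 - k) * (d2 - k) := by
  obtain ⟨m, rfl⟩ := Nat.exists_eq_add_of_le hk1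
  obtain ⟨n, rfl⟩ := Nat.exists_eq_add_of_le hk2
  let E := Matrix (Fin (k + m)) (Fin (k + n)) F
  let f : E →ₗ[F] (Fin (Module.finrank F (E ⧸ V)) → F) :=
    (Module.finBasis F (E ⧸ V)).equivFun.toLinearMap ∘ₗ V.mkQ
  have hf : ∀ N, f N = 0 ↔ N ∈ V := by
    intro N
    simp [f]
  let L : Fin (Module.finrank F (E ⧸ V)) → Matrix (Fin k ⊕ Fin m) (Fin k ⊕ Fin n) F :=
    fun t => Matrix.of fun i j =>
      f (Matrix.single (finSumFinEquiv i) (finSumFinEquiv j) 1) t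
  have hsum : ∀ (N : E) t, f N t =
      ∑ i, ∑ j, L t i j * N (finSumFinEquiv i) (finSumFinEquiv j) := by
    intro N t
    have h1 : N = ∑ i, ∑ j, N i j • Matrix.single i j (1 : F) := by
      conv_lhs => rw [Matrix.matrix_eq_sum_single N]
      simp
    conv_lhs => rw [h1]
    simp only [map_sum, map_smul, Finset.sum_apply, Pi.smul_apply, smul_eq_mul]
    rw [← finSumFinEquiv.sum_comp]
    refine Finset.sum_congr rfl fun i _ => ?_
    rw [← finSumFinEquiv.sum_comp]
    exact Finset.sum_congr rfl fun j _ => mul_comm _ _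
  have hcard := Matrix.card_le_card_of_forall_rank_le L fun N hN hLN => by
    have h0 : N.submatrix finSumFinEquiv.symm finSumFinEquiv.symm = 0 := by
      refine hV _ ((hf _).mp (funext fun t => ?_)) ?_
      · rw [hsum]
        simpa using hLN t
      · rw [Matrix.rank_submatrix]
        simpa using hN
    ext i j
    simpa using congrFun (congrFun h0 (finSumFinEquiv i)) (finSumFinEquiv j)
  have hdim := V.finrank_quotient_add_finrank
  have hE : Module.finrank F E = (k + m) * (k + n) := by
    simp [E, Module.finrank_matrix]
  rw [hE] at hdim
  simp only [Fintype.card_sum, Fintype.card_prod, Fintype.card_fin] at hcard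
  simp only [Nat.add_sub_cancel_left]
  nlinarith

section Hermitian

variable {ι : Type*} [Fintype ι]

theorem Matrix.IsHermitian.star_eigenvectorUnitary_mulVec_mulVec [DecidableEq ι] {W : Matrix ι ι ℂ}
    (hW : W.IsHermitian) (v : ι → ℂ) (i : ι) :
    (star (hW.eigenvectorUnitary : Matrix ι ι ℂ) *ᵥ (W *ᵥ v)) i =
      hW.eigenvalues i * (star (hW.eigenvectorUnitary : Matrix ι ι ℂ) *ᵥ v) i := by
  have h : star (hW.eigenvectorUnitary : Matrix ι ι ℂ) * W =
      Matrix.diagonal (fun i => (hW.eigenvalues i : ℂ)) *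
        star (hW.eigenvectorUnitary : Matrix ι ι ℂ) := by
    have hsp := congrArg (star (hW.eigenvectorUnitary : Matrix ι ι ℂ) * ·) hW.spectral_theorem
    simp only [Unitary.conjStarAlgAut_apply, ← Matrix.mul_assoc, Unitary.coe_star_mul_self,
      Matrix.one_mul] at hsp
    exact hsp
  rw [Matrix.mulVec_mulVec, h, ← Matrix.mulVec_mulVec, Matrix.mulVec_diagonal]

theorem Matrix.IsHermitian.re_star_dotProduct_mulVec [DecidableEq ι] {W : Matrix ι ι ℂ}
    (hW : W.IsHermitian) (v : ι → ℂ) :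
    (star v ⬝ᵥ W *ᵥ v).re = ∑ i, hW.eigenvalues i *
      Complex.normSq ((star (hW.eigenvectorUnitary : Matrix ι ι ℂ) *ᵥ v) i) := by
  set U := (hW.eigenvectorUnitary : Matrix ι ι ℂ) with hU
  have hUU : U * star U = 1 := Unitary.coe_mul_star_self _
  have h : star v ⬝ᵥ W *ᵥ v = star (star U *ᵥ v) ⬝ᵥ (star U *ᵥ (W *ᵥ v)) := by
    rw [Matrix.star_mulVec, Matrix.dotProduct_mulVec _ (star U), Matrix.vecMul_vecMul,
      Matrix.star_eq_conjTranspose, Matrix.conjTranspose_conjTranspose,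
      ← Matrix.star_eq_conjTranspose, hUU, Matrix.vecMul_one]
  rw [h, dotProduct, Complex.re_sum]
  refine Finset.sum_congr rfl fun i _ => ?_
  rw [hW.star_eigenvectorUnitary_mulVec_mulVec, Pi.star_apply, mul_left_comm, Complex.re_ofReal_mul,
    ← hU, Complex.star_def, ← Complex.normSq_eq_conj_mul_self, Complex.ofReal_re]

theorem Matrix.PosSemidef.re_trace_mul_nonneg {A B : Matrix ι ι ℂ} (hA : A.PosSemidef)
    (hB : B.PosSemidef) : 0 ≤ (A * B).trace.re := by
  obtain ⟨r, v, rfl⟩ := Matrix.posSemidef_iff_eq_sum_vecMulVec.mp hB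
  rw [Matrix.mul_sum, Matrix.trace_sum, Complex.re_sum]
  refine Finset.sum_nonneg fun i _ => ?_
  rw [Matrix.mul_vecMulVec, Matrix.trace_vecMulVec, dotProduct_comm]
  exact (Complex.nonneg_iff.mp (hA.dotProduct_mulVec_nonneg (v i))).1

end Hermitian

theorem re_star_dotProduct_mulVec_neg_of_mem_negSpace {d1 d2 : ℕ}
    {W : Matrix (Fin d1 × Fin d2) (Fin d1 × Fin d2) ℂ} (hW : W.IsHermitian)
    {v : Fin d1 × Fin d2 → ℂ} (hv : v ∈ negSpace W) (hv0 : v ≠ 0) :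
    (star v ⬝ᵥ W *ᵥ v).re < 0 := by
  set U := (hW.eigenvectorUnitary : Matrix (Fin d1 × Fin d2) (Fin d1 × Fin d2) ℂ) with hU
  have hzero : ∀ i, 0 ≤ hW.eigenvalues i → (star U *ᵥ v) i = 0 := by
    intro i hi
    have hle : negSpace W ≤ LinearMap.ker (LinearMap.proj i ∘ₗ (star U).mulVecLin) := by
      refine iSup₂_le fun μ hμ u hu => ?_
      rw [Module.End.mem_eigenspace_iff, Matrix.toLin'_apply] at hu
      have h := hW.star_eigenvectorUnitary_mulVec_mulVec u i
      rw [hu, Matrix.mulVec_smul, Pi.smul_apply, smul_eq_mul] at h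
      refine (mul_eq_mul_right_iff.mp h).resolve_left fun h' => ?_
      exact (hμ.trans_le hi).ne (by exact_mod_cast h')
    exact hle hv
  have hne : ∃ i, (star U *ᵥ v) i ≠ 0 := by
    by_contra! h
    apply hv0
    have h' : star U *ᵥ v = 0 := funext h
    rw [← Matrix.one_mulVec v, ← show U * star U = 1 from Unitary.coe_mul_star_self _,
      ← Matrix.mulVec_mulVec, h', Matrix.mulVec_zero]
  rw [hW.re_star_dotProduct_mulVec]
  have hneg : ∀ i, (star U *ᵥ v) i ≠ 0 →
      hW.eigenvalues i * Complex.normSq ((star U *ᵥ v) i) < 0 := fun i hi =>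
    mul_neg_of_neg_of_pos (not_le.mp fun h => hi (hzero i h)) (Complex.normSq_pos.mpr hi)
  obtain ⟨i, hi⟩ := hne
  refine Finset.sum_neg' (fun j _ => ?_) ⟨i, Finset.mem_univ _, hneg i hi⟩
  by_cases hj : (star U *ᵥ v) j = 0
  · rw [← hU, hj]; simp
  · exact (hneg j hj).le

theorem posSemidef_of_negSpace_eq_bot {d1 d2 : ℕ}
    {W : Matrix (Fin d1 × Fin d2) (Fin d1 × Fin d2) ℂ} (hW : W.IsHermitian)
    (h : negSpace W = ⊥) : W.PosSemidef := by
  refine hW.posSemidef_iff_eigenvalues_nonneg.mpr fun i => ?_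
  by_contra! hi
  have hmem : ((hW.eigenvectorBasis i).ofLp) ∈ negSpace W := by
    refine Submodule.mem_iSup_of_mem (hW.eigenvalues i) (Submodule.mem_iSup_of_mem hi ?_)
    rw [Module.End.mem_eigenspace_iff, Matrix.toLin'_apply, hW.mulVec_eigenvectorBasis]
    rfl
  rw [h, Submodule.mem_bot] at hmem
  exact hW.eigenvectorBasis.orthonormal.ne_zero i (WithLp.ofLp_injective 2 hmem)

/-- For any `k`-Schmidt witness `W` on `ℂ^{d1} ⊗ ℂ^{d2}` with `d1 ≤ d2`, the dimension of
the negative eigenspace `V₋` satisfies `1 ≤ dim V₋ ≤ (d1 - k) * (d2 - k)`. -/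
theorem negSpace_dim_bounds (d1 d2 k : ℕ) (hd : d1 ≤ d2) (hk1 : 1 ≤ k) (hk : k ≤ d1)
    (W : Matrix (Fin d1 × Fin d2) (Fin d1 × Fin d2) ℂ)
    (hW : IsSchmidtWitness k W) :
    1 ≤ Module.finrank ℂ (negSpace W) ∧
      Module.finrank ℂ (negSpace W) ≤ (d1 - k) * (d2 - k) := by
  constructor
  · rw [Submodule.one_le_finrank_iff]
    intro h
    obtain ⟨ρ, hρ, -, hneg⟩ := hW.detects
    exact hneg.not_ge (hρ.re_trace_mul_nonneg (posSemidef_of_negSpace_eq_bot hW.herm h))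
  · let e : (Fin d1 × Fin d2 → ℂ) ≃ₗ[ℂ] Matrix (Fin d1) (Fin d2) ℂ :=
      LinearEquiv.curry ℂ ℂ (Fin d1) (Fin d2)
    rw [← LinearEquiv.finrank_map_eq e (negSpace W)]
    refine Matrix.finrank_le_mul_of_forall_rank_le hk (hk.trans hd) _ ?_
    rintro _ ⟨v, hv, rfl⟩ hr
    by_contra hne
    have hv0 : v ≠ 0 := by
      rintro rfl
      exact hne (map_zero e)
    exact (re_star_dotProduct_mulVec_neg_of_mem_negSpace hW.herm hv hv0).not_ge (hW.pos v hr)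
end

section
/- If W is a k-Schmidt witness on ℂ^{d1} ⊗ ℂ^{d2} whose kernel contains no nonzero vector of Schmidt rank at most k, then the dimension of its positive eigenspace satisfies dim V_+ ≥ k(d1 + d2) − k². -/
open Matrix
open scoped ComplexOrder

/-- The span of the eigenvectors of `W` corresponding to positive eigenvalues. -/
noncomputable def posSpace {d1 d2 : ℕ}
    (W : Matrix (Fin d1 × Fin d2) (Fin d1 × Fin d2) ℂ) :
    Submodule ℂ (Fin d1 × Fin d2 → ℂ) :=
  ⨆ (μ : ℝ) (_ : 0 < μ), Module.End.eigenspace (Matrix.toLin' W) (μ : ℂ)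

namespace Matrix

variable {m n : Type*}

lemma det_submatrix_eq_zero_of_rank_lt_s7 [Fintype n] {K : Type*} [Field K] {r : ℕ}
    (A : Matrix m n K) (h : A.rank < r) (f : Fin r → m) (g : Fin r → n) :
    (A.submatrix f g).det = 0 := by
  by_contra hdet
  have h1 := rank_of_det_ne_zero hdet
  have h2 := A.rank_submatrix_le f g
  rw [h1, Fintype.card_fin] at h2
  omega

lemma eval₂Hom_det_submatrix_mvPolynomialX {R M : Type*} [CommRing R] [CommRing M] (ψ : R →+* M)
    (Z : Matrix m n M) {r : ℕ} (f : Fin r → m) (g : Fin r → n) :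
    MvPolynomial.eval₂Hom ψ (fun q ↦ Z q.1 q.2) ((mvPolynomialX m n R).submatrix f g).det =
      (Z.submatrix f g).det := by
  rw [RingHom.map_det]
  congr 1
  ext i j
  simp

variable [Fintype m] [Fintype n]

lemma exists_linearIndependent_rows_of_le_rank {K : Type*} [Field K] {r : ℕ}
    (A : Matrix m n K) (h : r ≤ A.rank) :
    ∃ f : Fin r → m, LinearIndependent K (A.submatrix f id).row := by
  obtain ⟨κ, a, ha, hspan, hli⟩ := exists_linearIndependent' K A.row
  have : Finite κ := Finite.of_injective a ha
  have := Fintype.ofFinite κ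
  have hcard : Fintype.card κ = A.rank := by
    rw [rank_eq_finrank_span_row, ← hspan, finrank_span_eq_card hli]
  obtain ⟨e⟩ : Nonempty (Fin r ↪ κ) :=
    Function.Embedding.nonempty_of_card_le (by simpa [hcard] using h)
  exact ⟨a ∘ e, hli.comp e e.injective⟩

/-- A matrix of rank at least `r` has a nonvanishing `r × r` minor. -/
lemma exists_det_submatrix_ne_zero_of_le_rank {K : Type*} [Field K] {r : ℕ}
    (A : Matrix m n K) (h : r ≤ A.rank) :
    ∃ (f : Fin r → m) (g : Fin r → n), (A.submatrix f g).det ≠ 0 := by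
  obtain ⟨f, hf⟩ := A.exists_linearIndependent_rows_of_le_rank h
  have hr : r ≤ (A.submatrix f id)ᵀ.rank := by
    rw [rank_transpose, hf.rank_matrix, Fintype.card_fin]
  obtain ⟨g, hg⟩ := exists_linearIndependent_rows_of_le_rank _ hr
  refine ⟨f, g, ?_⟩
  rw [← det_transpose, ← isUnit_iff_ne_zero, ← isUnit_iff_isUnit_det]
  exact linearIndependent_rows_iff_isUnit.mp hg

/-- If the only matrix of rank at most `k` killed by a family of linear forms over an
algebraically closed field `F` is zero, then the same holds over every extension of `F`. -/
lemma eq_zero_of_rank_le_of_forall_sum_eq_zero {F L ι : Type*} [Field F] [IsAlgClosed F] [Field L]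
    {k : ℕ} (c : ι → Matrix m n F)
    (h : ∀ Y : Matrix m n F, Y.rank ≤ k → (∀ s, ∑ i, ∑ j, c s i j * Y i j = 0) → Y = 0)
    (φ : F →+* L) (Y : Matrix m n L) (hY : Y.rank ≤ k)
    (hc : ∀ s, ∑ i, ∑ j, φ (c s i j) * Y i j = 0) : Y = 0 := by
  let minor (p : (Fin (k + 1) → m) × (Fin (k + 1) → n)) : MvPolynomial (m × n) F :=
    ((mvPolynomialX m n F).submatrix p.1 p.2).det
  let form (s : ι) : MvPolynomial (m × n) F :=
    ∑ i, ∑ j, MvPolynomial.C (c s i j) * MvPolynomial.X (i, j)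
  let J := Ideal.span (Set.range minor ∪ Set.range form)
  have hJ : J ≤ RingHom.ker (MvPolynomial.eval₂Hom φ (fun q ↦ Y q.1 q.2)) := by
    refine Ideal.span_le.mpr (Set.union_subset ?_ ?_)
    · rintro _ ⟨p, rfl⟩
      exact (eval₂Hom_det_submatrix_mvPolynomialX φ Y p.1 p.2).trans
        (Y.det_submatrix_eq_zero_of_rank_lt_s7 (by omega) _ _)
    · rintro _ ⟨s, rfl⟩
      simpa [form] using hc s
  ext i j
  have hX : MvPolynomial.X (i, j) ∈ MvPolynomial.vanishingIdeal F (MvPolynomial.zeroLocus F J) := by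
    intro x hx
    rw [MvPolynomial.zeroLocus_span] at hx
    have hx0 : Matrix.of (fun i j ↦ x (i, j)) = 0 := by
      refine h _ ?_ fun s ↦ ?_
      · by_contra! hlt
        obtain ⟨f, g, hfg⟩ := exists_det_submatrix_ne_zero_of_le_rank _ hlt
        refine hfg ((eval₂Hom_det_submatrix_mvPolynomialX (RingHom.id F) _ f g).symm.trans ?_)
        exact hx _ (.inl ⟨(f, g), rfl⟩)
      · simpa [form] using hx _ (.inr ⟨s, rfl⟩)
    simpa using congr_fun₂ hx0 i j
  rw [MvPolynomial.vanishingIdeal_zeroLocus_eq_radical] at hX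
  obtain ⟨r, hr⟩ := hX
  have := hJ hr
  rw [RingHom.mem_ker, map_pow, MvPolynomial.eval₂Hom_X'] at this
  simpa using eq_zero_of_pow_eq_zero this

/-- Valuative argument: over an extension field `K`, the entries of a matrix of rank at most `k`
are integral over the algebra generated by the values of the linear forms `c`, provided that
the forms have no common nonzero zero of rank at most `k`. -/
lemma isIntegral_entry_of_rank_le {F K ι : Type*} [Field F] [IsAlgClosed F] [Field K]
    [Algebra F K] {k : ℕ} (c : ι → Matrix m n F)
    (h : ∀ Y : Matrix m n F, Y.rank ≤ k → (∀ s, ∑ i, ∑ j, c s i j * Y i j = 0) → Y = 0)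
    (X : Matrix m n K) (hX : X.rank ≤ k) (i : m) (j : n) :
    IsIntegral (Algebra.adjoin F
      (Set.range fun s ↦ ∑ i, ∑ j, algebraMap F K (c s i j) * X i j)) (X i j) := by
  set S : Set K := Set.range fun s ↦ ∑ i, ∑ j, algebraMap F K (c s i j) * X i j with hS
  by_contra hint
  obtain ⟨V, hV, hVX⟩ := Subring.exists_le_valuationSubring_of_isIntegrallyClosedIn
    (R := (integralClosure (Algebra.adjoin F S) K).toSubring) (x := X i j) hint
  have hmemV {x : K} (hx : x ∈ Algebra.adjoin F S) : x ∈ V :=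
    hV ((integralClosure (Algebra.adjoin F S) K).algebraMap_mem ⟨x, hx⟩)
  have : Nonempty (m × n) := ⟨(i, j)⟩
  obtain ⟨⟨i₀, j₀⟩, hmax⟩ := Finite.exists_max fun p : m × n ↦ V.valuation (X p.1 p.2)
  set x := X i₀ j₀ with hx
  have hxV : 1 < V.valuation x := by
    refine lt_of_lt_of_le ?_ (hmax (i, j))
    rwa [← not_le, V.valuation_le_one_iff]
  have hx0 : x ≠ 0 := by
    intro h0
    simp [h0] at hxV
  have hdiv (i j) : X i j / x ∈ V := by
    rw [← V.valuation_le_one_iff, map_div₀]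
    exact div_le_one_of_le₀ (hmax (i, j)) zero_le
  let Y : Matrix m n V := Matrix.of fun i j ↦ ⟨X i j / x, hdiv i j⟩
  let φ : F →+* V := (algebraMap F K).codRestrict V fun a ↦
    hmemV ((Algebra.adjoin F S).algebraMap_mem a)
  let res := IsLocalRing.residue V
  have hrank : (Y.map res).rank ≤ k := by
    by_contra! hlt
    obtain ⟨f, g, hfg⟩ := exists_det_submatrix_ne_zero_of_le_rank _ hlt
    have hYdet : (Y.submatrix f g).det = 0 := by
      apply Subtype.val_injective
      have hYX : V.subtype.mapMatrix (Y.submatrix f g) = x⁻¹ • X.submatrix f g := by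
        ext a b
        simp [Y, div_eq_inv_mul]
      change V.subtype _ = 0
      rw [RingHom.map_det, hYX, det_smul, X.det_submatrix_eq_zero_of_rank_lt_s7 (by omega), mul_zero]
    apply hfg
    have := congr_arg res hYdet
    rwa [RingHom.map_det, map_zero] at this
  have hzero : Y.map res = 0 := by
    refine eq_zero_of_rank_le_of_forall_sum_eq_zero c h (res.comp φ) _ hrank fun s ↦ ?_
    have hmem : ∑ i, ∑ j, φ (c s i j) * Y i j ∈ IsLocalRing.maximalIdeal V := by
      rw [V.valuation_lt_one_iff]
      have : ((∑ i, ∑ j, φ (c s i j) * Y i j : V) : K)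
          = (∑ i, ∑ j, algebraMap F K (c s i j) * X i j) * x⁻¹ := by
        simp [φ, Y, Finset.sum_mul, div_eq_mul_inv, mul_assoc]
      rw [this, map_mul, map_inv₀]
      have hle := (V.valuation_le_one_iff _).mpr
        (hmemV (Algebra.subset_adjoin (Set.mem_range_self s)))
      exact lt_of_le_of_lt (mul_le_of_le_one_left' hle) (inv_lt_one_of_one_lt₀ hxV)
    simpa [map_sum] using (IsLocalRing.residue_eq_zero_iff _).mpr hmem
  have h1 : Y i₀ j₀ = 1 := Subtype.ext (div_self hx0)
  have := congr_fun₂ hzero i₀ j₀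
  simp [h1] at this

section Generic

variable (F a b c : Type*) [Field F]

/-- The field of rational functions in the entries of the blocks `A`, `B`, `C` of a block matrix
`[A B; C D]`. -/
abbrev BlockFunctionField : Type _ := FractionRing (MvPolynomial (a × a ⊕ a × b ⊕ c × a) F)

/-- The coordinate functions of `BlockFunctionField`. -/
noncomputable def blockVar (s : a × a ⊕ a × b ⊕ c × a) : BlockFunctionField F a b c :=
  algebraMap _ _ (MvPolynomial.X s : MvPolynomial (a × a ⊕ a × b ⊕ c × a) F)

lemma algebraicIndependent_blockVar : AlgebraicIndependent F (blockVar F a b c) :=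
  (MvPolynomial.algebraicIndependent_X (a × a ⊕ a × b ⊕ c × a) F).map'
    (f := IsScalarTower.toAlgHom F (MvPolynomial (a × a ⊕ a × b ⊕ c × a) F)
      (BlockFunctionField F a b c))
    (IsFractionRing.injective _ _)

lemma isAlgebraic_of_isIntegral_blockVar (B : Subalgebra F (BlockFunctionField F a b c))
    (hB : ∀ s, IsIntegral B (blockVar F a b c s)) :
    Algebra.IsAlgebraic B (BlockFunctionField F a b c) := by
  have hpoly (p : MvPolynomial (a × a ⊕ a × b ⊕ c × a) F) :
      IsIntegral B (algebraMap _ (BlockFunctionField F a b c) p) := by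
    induction p using MvPolynomial.induction_on with
    | C r =>
      have : algebraMap (MvPolynomial (a × a ⊕ a × b ⊕ c × a) F) (BlockFunctionField F a b c)
          (MvPolynomial.C r) =
          algebraMap B _ (algebraMap F B r) := by
        rw [← IsScalarTower.algebraMap_apply, ← MvPolynomial.algebraMap_eq,
          ← IsScalarTower.algebraMap_apply]
      rw [this]
      exact isIntegral_algebraMap
    | add p q hp hq => rw [map_add]; exact hp.add hq
    | mul_X p s hp => rw [map_mul]; exact hp.mul (hB s)
  refine ⟨fun z ↦ ?_⟩
  obtain ⟨x, y, -, rfl⟩ :=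
    IsFractionRing.div_surjective (A := MvPolynomial (a × a ⊕ a × b ⊕ c × a) F) z
  rw [div_eq_mul_inv]
  exact (hpoly x).isAlgebraic.mul (hpoly y).isAlgebraic.inv

variable [Fintype a] [DecidableEq a] [Fintype b]

/-- The generic matrix of rank `card a`, in block form `[A B; C CA⁻¹B]`. -/
noncomputable def genericBlockMatrix : Matrix (a ⊕ c) (a ⊕ b) (BlockFunctionField F a b c) :=
  let A : Matrix a a _ := of fun i j ↦ blockVar F a b c (.inl (i, j))
  let B : Matrix a b _ := of fun i j ↦ blockVar F a b c (.inr (.inl (i, j)))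
  let C : Matrix c a _ := of fun i j ↦ blockVar F a b c (.inr (.inr (i, j)))
  fromBlocks A B C (C * A⁻¹ * B)

lemma rank_genericBlockMatrix_le [Fintype c] :
    (genericBlockMatrix F a b c).rank ≤ Fintype.card a := by
  let A : Matrix a a (BlockFunctionField F a b c) := of fun i j ↦ blockVar F a b c (.inl (i, j))
  let B : Matrix a b (BlockFunctionField F a b c) :=
    of fun i j ↦ blockVar F a b c (.inr (.inl (i, j)))
  let C : Matrix c a (BlockFunctionField F a b c) :=
    of fun i j ↦ blockVar F a b c (.inr (.inr (i, j)))
  let ψ : MvPolynomial (a × a) F →ₐ[F] BlockFunctionField F a b c :=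
    MvPolynomial.aeval fun p ↦ blockVar F a b c (.inl p)
  have hψ : Function.Injective ψ :=
    (algebraicIndependent_blockVar F a b c).comp _ Sum.inl_injective
  have hA : A.det ≠ 0 := by
    have : A.det = ψ (mvPolynomialX a a F).det := by
      rw [AlgHom.map_det]
      congr 1
      ext i j
      simp [A, ψ]
    rw [this, map_ne_zero_iff _ hψ]
    exact det_mvPolynomialX_ne_zero a F
  have hA' : IsUnit A.det := hA.isUnit
  have : genericBlockMatrix F a b c = fromRows 1 (C * A⁻¹) * fromCols A B := by
    rw [fromRows_mul_fromCols, Matrix.one_mul, Matrix.one_mul, nonsing_inv_mul_cancel_right _ _ hA']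
    rfl
  rw [this]
  exact (rank_mul_le_left _ _).trans (rank_le_card_width _)

/-- If a family of linear forms on block matrices has no common nonzero zero of rank at most
`card a`, then it has at least as many members as the determinantal variety has dimension. -/
theorem card_le_of_forall_rank_le_eq_zero {ι : Type*} [IsAlgClosed F] [Fintype c] [Fintype ι]
    (l : ι → Matrix (a ⊕ c) (a ⊕ b) F)
    (h : ∀ Y : Matrix (a ⊕ c) (a ⊕ b) F, Y.rank ≤ Fintype.card a →
      (∀ s, ∑ i, ∑ j, l s i j * Y i j = 0) → Y = 0) :
    Fintype.card (a × a ⊕ a × b ⊕ c × a) ≤ Fintype.card ι := by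
  have hint := isIntegral_entry_of_rank_le l h _ (rank_genericBlockMatrix_le F a b c)
  have halg := isAlgebraic_of_isIntegral_blockVar F a b c _ fun s ↦ show IsIntegral _ _ from
    match s with
    | .inl (i, j) => hint (.inl i) (.inl j)
    | .inr (.inl (i, j)) => hint (.inl i) (.inr j)
    | .inr (.inr (i, j)) => hint (.inr i) (.inl j)
  have h1 := (algebraicIndependent_blockVar F a b c).lift_cardinalMk_le_trdeg
  let f (s : ι) := ∑ i, ∑ j, algebraMap F _ (l s i j) * genericBlockMatrix F a b c i j
  have := Fintype.ofFinite (Set.range f)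
  have h2 : Algebra.trdeg F (BlockFunctionField F a b c) ≤ Fintype.card (Set.range f) := by
    rw [← Cardinal.mk_fintype]
    exact Algebra.IsAlgebraic.trdeg_le_cardinalMk F _ (alg := halg)
  have h3 := h1.trans (Cardinal.lift_le.mpr h2)
  simp only [Cardinal.mk_fintype, Cardinal.lift_natCast, Nat.cast_le] at h3
  exact h3.trans (Fintype.card_le_of_surjective _ Set.rangeFactorization_surjective)

end Generic

end Matrix

/-- A subspace of `ℂ^{d1} ⊗ ℂ^{d2}` containing no nonzero vector of Schmidt rank at most `k` has
codimension at least `k * (d1 + d2) - k ^ 2`. -/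
theorem add_finrank_le_of_forall_schmidtRank_le {d1 d2 k : ℕ} (h1 : k ≤ d1) (h2 : k ≤ d2)
    (V : Submodule ℂ (Fin d1 × Fin d2 → ℂ)) (hV : ∀ Ψ ∈ V, schmidtRank Ψ ≤ k → Ψ = 0) :
    k * (d1 + d2) - k ^ 2 + Module.finrank ℂ V ≤ d1 * d2 := by
  let e₁ : Fin k ⊕ Fin (d1 - k) ≃ Fin d1 := Fintype.equivOfCardEq (by simp [h1])
  let e₂ : Fin k ⊕ Fin (d2 - k) ≃ Fin d2 := Fintype.equivOfCardEq (by simp [h2])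
  let b := Module.finBasis ℂ ((Fin d1 × Fin d2 → ℂ) ⧸ V)
  let f s : (Fin d1 × Fin d2 → ℂ) →ₗ[ℂ] ℂ := b.coord s ∘ₗ V.mkQ
  have hcard := Matrix.card_le_of_forall_rank_le_eq_zero ℂ (Fin k) (Fin (d2 - k)) (Fin (d1 - k))
    (fun s ↦ Matrix.of fun i j ↦ f s (Pi.single (e₁ i, e₂ j) 1)) fun Y hY hYf ↦ by
      let Ψ : Fin d1 × Fin d2 → ℂ := fun p ↦ Y (e₁.symm p.1) (e₂.symm p.2)
      have hΨrank : schmidtRank Ψ ≤ k := by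
        have : coordMat Ψ = Y.reindex e₁ e₂ := rfl
        rw [schmidtRank, this, Matrix.rank_reindex]
        simpa using hY
      have hΨf s : f s Ψ = 0 := by
        refine Eq.trans ?_ (hYf s)
        rw [LinearMap.pi_apply_eq_sum_univ, Fintype.sum_prod_type, ← e₁.sum_comp]
        refine Finset.sum_congr rfl fun i _ ↦ ?_
        rw [← e₂.sum_comp]
        refine Finset.sum_congr rfl fun j _ ↦ ?_
        simp only [Ψ, Equiv.symm_apply_apply, smul_eq_mul, Matrix.of_apply, mul_comm (Y i j)]
        congr 2
        ext p
        simp [Pi.single_apply, eq_comm]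
      have hΨV : Ψ ∈ V := by
        rw [← Submodule.Quotient.mk_eq_zero]
        exact b.ext_elem fun s ↦ by simpa [f] using hΨf s
      ext i j
      simpa [Ψ] using congr_fun (hV Ψ hΨV hΨrank) (e₁ i, e₂ j)
  have hquot := V.finrank_quotient_add_finrank
  simp only [Fintype.card_sum, Fintype.card_prod, Fintype.card_fin, Module.finrank_pi]
    at hcard hquot
  obtain ⟨m, rfl⟩ := Nat.exists_eq_add_of_le h1
  obtain ⟨n, rfl⟩ := Nat.exists_eq_add_of_le h2
  have hdim : k * (k + m + (k + n)) - k ^ 2 = k * k + (k * n + m * k) := by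
    rw [Nat.sub_eq_iff_eq_add (by nlinarith)]
    ring
  simp only [Nat.add_sub_cancel_left] at hcard
  omega

section Hermitian

variable {n : Type*} [Fintype n] [DecidableEq n] {W : Matrix n n ℂ}

namespace Matrix.IsHermitian

/-- The span of the eigenvectors of a Hermitian matrix with nonpositive eigenvalues. -/
noncomputable def nonposSpace (hW : W.IsHermitian) : Submodule ℂ (n → ℂ) :=
  Submodule.span ℂ ((fun i ↦ (hW.eigenvectorBasis i : n → ℂ)) '' {i | hW.eigenvalues i ≤ 0})

lemma star_dotProduct_eigenvectorBasis (hW : W.IsHermitian) (i j : n) :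
    star (hW.eigenvectorBasis i : n → ℂ) ⬝ᵥ (hW.eigenvectorBasis j : n → ℂ) =
      if i = j then 1 else 0 := by
  rw [← orthonormal_iff_ite.mp hW.eigenvectorBasis.orthonormal i j, dotProduct_comm]
  rfl

lemma mulVec_eq_zero_of_mem_nonposSpace (hW : W.IsHermitian) {Ψ : n → ℂ}
    (hΨ : Ψ ∈ hW.nonposSpace) (hpos : 0 ≤ (star Ψ ⬝ᵥ W *ᵥ Ψ).re) : W *ᵥ Ψ = 0 := by
  obtain ⟨c, hc, rfl⟩ : ∃ c : n → ℂ, (∀ i, 0 < hW.eigenvalues i → c i = 0) ∧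
      ∑ i, c i • (hW.eigenvectorBasis i : n → ℂ) = Ψ := by
    rw [nonposSpace, Finsupp.mem_span_image_iff_linearCombination] at hΨ
    obtain ⟨l, hl, rfl⟩ := hΨ
    refine ⟨l, fun i hi ↦ ?_, ?_⟩
    · by_contra hli
      exact hi.not_ge (hl (Finsupp.mem_support_iff.mpr hli))
    · rw [Finsupp.linearCombination_apply, Finsupp.sum_fintype _ _ (by simp)]
  have hmul : W *ᵥ ∑ i, c i • (hW.eigenvectorBasis i : n → ℂ) =
      ∑ i, (hW.eigenvalues i * c i) • (hW.eigenvectorBasis i : n → ℂ) := by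
    rw [mulVec_sum]
    refine Finset.sum_congr rfl fun i _ ↦ ?_
    rw [mulVec_smul, hW.mulVec_eigenvectorBasis, mul_comm, mul_smul]
    rfl
  have hquad : (star (∑ i, c i • (hW.eigenvectorBasis i : n → ℂ)) ⬝ᵥ
      W *ᵥ ∑ i, c i • (hW.eigenvectorBasis i : n → ℂ)).re =
      ∑ i, hW.eigenvalues i * Complex.normSq (c i) := by
    rw [hmul, star_sum, sum_dotProduct, Complex.re_sum]
    refine Finset.sum_congr rfl fun i _ ↦ ?_
    simp only [dotProduct_sum, star_smul, smul_dotProduct, dotProduct_smul,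
      star_dotProduct_eigenvectorBasis, smul_eq_mul, mul_ite, mul_one, mul_zero,
      Finset.sum_ite_eq, Finset.mem_univ, if_true]
    simp [Complex.normSq_apply]
    ring
  have hterm i : hW.eigenvalues i * Complex.normSq (c i) ≤ 0 := by
    rcases lt_or_ge 0 (hW.eigenvalues i) with hi | hi
    · simp [hc i hi]
    · exact mul_nonpos_of_nonpos_of_nonneg hi (Complex.normSq_nonneg _)
  rw [hquad] at hpos
  have hzero := (Finset.sum_eq_zero_iff_of_nonpos fun i _ ↦ hterm i).mp
    ((Finset.sum_nonpos fun i _ ↦ hterm i).antisymm hpos)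
  rw [hmul]
  refine Finset.sum_eq_zero fun i hi ↦ ?_
  have := hzero i hi
  simp only [mul_eq_zero, Complex.normSq_eq_zero] at this
  rcases this with h | h <;> simp [h]

end Matrix.IsHermitian

end Hermitian

lemma posSpace_sup_nonposSpace {d1 d2 : ℕ} {W : Matrix (Fin d1 × Fin d2) (Fin d1 × Fin d2) ℂ}
    (hW : W.IsHermitian) : posSpace W ⊔ hW.nonposSpace = ⊤ := by
  have hspan : Submodule.span ℂ (Set.range fun i ↦ (hW.eigenvectorBasis i : _ → ℂ)) = ⊤ := by
    have := hW.eigenvectorBasis.toBasis.map (WithLp.linearEquiv 2 ℂ (Fin d1 × Fin d2 → ℂ))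
      |>.span_eq
    rw [← this]
    congr 2
  rw [eq_top_iff, ← hspan, Submodule.span_le]
  rintro _ ⟨i, rfl⟩
  rcases lt_or_ge 0 (hW.eigenvalues i) with hi | hi
  · refine Submodule.mem_sup_left (Submodule.mem_iSup_of_mem _ (Submodule.mem_iSup_of_mem hi ?_))
    rw [Module.End.mem_eigenspace_iff, Matrix.toLin'_apply, hW.mulVec_eigenvectorBasis]
    rfl
  · exact Submodule.mem_sup_right (Submodule.subset_span ⟨i, hi, rfl⟩)

/-- If `W` is a `k`-Schmidt witness whose kernel contains no nonzero vector of Schmidt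
rank at most `k`, then `dim V₊ ≥ k * (d1 + d2) - k²`. -/
theorem posSpace_dim_lower_bound (d1 d2 k : ℕ) (hd : d1 ≤ d2) (hk1 : 1 ≤ k) (hk : k ≤ d1)
    (W : Matrix (Fin d1 × Fin d2) (Fin d1 × Fin d2) ℂ)
    (hW : IsSchmidtWitness k W)
    (hker : ∀ Ψ ∈ LinearMap.ker (Matrix.toLin' W), schmidtRank Ψ ≤ k → Ψ = 0) :
    k * (d1 + d2) - k ^ 2 ≤ Module.finrank ℂ (posSpace W) := by
  have hcodim := add_finrank_le_of_forall_schmidtRank_le hk (hk.trans hd) hW.herm.nonposSpace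
    fun Ψ hΨ hr ↦ hker Ψ (hW.herm.mulVec_eq_zero_of_mem_nonposSpace hΨ (hW.pos Ψ hr)) hr
  have hsup := Submodule.finrank_add_le_finrank_add_finrank (posSpace W) hW.herm.nonposSpace
  rw [posSpace_sup_nonposSpace, finrank_top, Module.finrank_pi, Fintype.card_prod,
    Fintype.card_fin, Fintype.card_fin] at hsup
  omega
end

section
/- The partial transpose of an entangled positive semidefinite operator of unit trace on ℂ² ⊗ ℂ² has exactly one negative eigenvalue and three positive eigenvalues. -/
open Matrix
open scoped ComplexOrder

/-- The simple tensor `φ ⊗ χ`. -/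
def tensorVec {d1 d2 : ℕ} (φ : Fin d1 → ℂ) (χ : Fin d2 → ℂ) : Fin d1 × Fin d2 → ℂ :=
  fun p => φ p.1 * χ p.2

/-- A state is separable if it is a convex combination of projectors onto product
vectors (here written as a combination of outer products of unit product vectors). -/
def IsSeparableState {d1 d2 : ℕ} (ρ : Matrix (Fin d1 × Fin d2) (Fin d1 × Fin d2) ℂ) : Prop :=
  ∃ (n : ℕ) (p : Fin n → ℝ) (φ : Fin n → Fin d1 → ℂ) (χ : Fin n → Fin d2 → ℂ),
    (∀ i, 0 ≤ p i) ∧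
    (∀ i, star (tensorVec (φ i) (χ i)) ⬝ᵥ tensorVec (φ i) (χ i) = 1) ∧
    ρ = ∑ i, (p i : ℂ) •
      Matrix.vecMulVec (tensorVec (φ i) (χ i)) (star (tensorVec (φ i) (χ i)))

/-- The partial transpose (in the second subsystem): `(ρ^Γ)_{ij,kl} = ρ_{il,kj}`. -/
def partialTranspose {d1 d2 : ℕ} (ρ : Matrix (Fin d1 × Fin d2) (Fin d1 × Fin d2) ℂ) :
    Matrix (Fin d1 × Fin d2) (Fin d1 × Fin d2) ℂ :=
  Matrix.of fun x y => ρ (x.1, y.2) (y.1, x.2)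

open scoped Kronecker

section Separable

variable {d1 d2 : ℕ}

lemma partialTranspose_apply (ρ : Matrix (Fin d1 × Fin d2) (Fin d1 × Fin d2) ℂ)
    (i : Fin d1) (j : Fin d2) (k : Fin d1) (l : Fin d2) :
    partialTranspose ρ (i, j) (k, l) = ρ (i, l) (k, j) := rfl

lemma partialTranspose_partialTranspose (ρ : Matrix (Fin d1 × Fin d2) (Fin d1 × Fin d2) ℂ) :
    partialTranspose (partialTranspose ρ) = ρ := rfl

lemma Matrix.IsHermitian.partialTranspose {ρ : Matrix (Fin d1 × Fin d2) (Fin d1 × Fin d2) ℂ}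
    (hρ : ρ.IsHermitian) : (partialTranspose ρ).IsHermitian := by
  ext ⟨i, j⟩ ⟨k, l⟩
  exact hρ.apply (i, l) (k, j)

/-- The (unnormalized) projector onto a product vector. -/
noncomputable def productProj (φ : Fin d1 → ℂ) (χ : Fin d2 → ℂ) :
    Matrix (Fin d1 × Fin d2) (Fin d1 × Fin d2) ℂ :=
  vecMulVec (tensorVec φ χ) (star (tensorVec φ χ))

lemma partialTranspose_productProj (φ : Fin d1 → ℂ) (χ : Fin d2 → ℂ) :
    partialTranspose (productProj φ χ) = productProj φ (star χ) := by
  ext ⟨i, j⟩ ⟨k, l⟩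
  simp only [partialTranspose_apply, productProj, vecMulVec_apply, tensorVec, Pi.star_apply,
    star_mul, star_star]
  ring

lemma IsSeparableState.zero :
    IsSeparableState (0 : Matrix (Fin d1 × Fin d2) (Fin d1 × Fin d2) ℂ) :=
  ⟨0, 0, fun i => i.elim0, fun i => i.elim0, fun i => i.elim0, fun i => i.elim0, by simp⟩

lemma IsSeparableState.add {ρ σ : Matrix (Fin d1 × Fin d2) (Fin d1 × Fin d2) ℂ}
    (hρ : IsSeparableState ρ) (hσ : IsSeparableState σ) : IsSeparableState (ρ + σ) := by
  obtain ⟨n, p, φ, χ, hp, h1, rfl⟩ := hρ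
  obtain ⟨m, q, φ', χ', hq, h1', rfl⟩ := hσ
  refine ⟨n + m, Fin.append p q, Fin.append φ φ', Fin.append χ χ', fun i => ?_, fun i => ?_, ?_⟩
  · refine Fin.addCases (fun i => ?_) (fun i => ?_) i <;> simp [hp, hq]
  · refine Fin.addCases (fun i => ?_) (fun i => ?_) i <;> simp [h1, h1']
  · simp [Fin.sum_univ_add]

lemma IsSeparableState.smul {ρ : Matrix (Fin d1 × Fin d2) (Fin d1 × Fin d2) ℂ}
    (hρ : IsSeparableState ρ) {t : ℝ} (ht : 0 ≤ t) : IsSeparableState ((t : ℂ) • ρ) := by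
  obtain ⟨n, p, φ, χ, hp, h1, rfl⟩ := hρ
  refine ⟨n, fun i => t * p i, φ, χ, fun i => mul_nonneg ht (hp i), h1, ?_⟩
  simp only [Finset.smul_sum, smul_smul, Complex.ofReal_mul]

lemma tensorVec_smul_left (c : ℂ) (φ : Fin d1 → ℂ) (χ : Fin d2 → ℂ) :
    tensorVec (c • φ) χ = c • tensorVec φ χ := by
  ext p
  simp [tensorVec, mul_assoc]

lemma isSeparableState_productProj (φ : Fin d1 → ℂ) (χ : Fin d2 → ℂ) :
    IsSeparableState (productProj φ χ) := by
  by_cases h : tensorVec φ χ = 0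
  · simpa [productProj, h] using IsSeparableState.zero
  have hpos : 0 < star (tensorVec φ χ) ⬝ᵥ tensorVec φ χ := dotProduct_star_self_pos_iff.2 h
  obtain ⟨r, hr, hrv⟩ := RCLike.pos_iff_exists_ofReal.1 hpos
  have hrv' : star (tensorVec φ χ) ⬝ᵥ tensorVec φ χ = (r : ℂ) := hrv.symm
  have hs : ((Real.sqrt r : ℝ) : ℂ) * ((Real.sqrt r : ℝ) : ℂ) = r := by
    rw [← Complex.ofReal_mul, Real.mul_self_sqrt hr.le]
  have hr0 : (r : ℂ) ≠ 0 := by exact_mod_cast hr.ne'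
  have hs0 : ((Real.sqrt r : ℝ) : ℂ) ≠ 0 := by
    exact_mod_cast (Real.sqrt_pos.2 hr).ne'
  refine ⟨1, fun _ => r, fun _ => ((Real.sqrt r : ℝ) : ℂ)⁻¹ • φ, fun _ => χ, fun _ => hr.le,
    fun _ => ?_, ?_⟩
  · rw [tensorVec_smul_left, star_smul, smul_dotProduct, dotProduct_smul, hrv']
    simp only [star_inv₀, RCLike.star_def, Complex.conj_ofReal, smul_eq_mul]
    rw [← hs]
    field_simp
  · simp only [Finset.univ_unique, Finset.sum_singleton, tensorVec_smul_left, star_smul,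
      smul_vecMulVec, vecMulVec_smul, smul_smul, star_inv₀, RCLike.star_def, Complex.conj_ofReal]
    rw [show (r : ℂ) * ((↑√r)⁻¹ * (↑√r)⁻¹) = 1 by rw [← hs]; field_simp, one_smul, productProj]

lemma kronecker_mulVec_tensorVec (A : Matrix (Fin d1) (Fin d1) ℂ) (B : Matrix (Fin d2) (Fin d2) ℂ)
    (φ : Fin d1 → ℂ) (χ : Fin d2 → ℂ) :
    (A ⊗ₖ B) *ᵥ tensorVec φ χ = tensorVec (A *ᵥ φ) (B *ᵥ χ) := by
  ext ⟨i, j⟩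
  simp only [mulVec, dotProduct, Fintype.sum_prod_type, kronecker_apply, tensorVec,
    Finset.sum_mul_sum]
  refine Finset.sum_congr rfl fun _ _ => Finset.sum_congr rfl fun _ _ => ?_
  ring

lemma IsSeparableState.kronecker_conj {ρ : Matrix (Fin d1 × Fin d2) (Fin d1 × Fin d2) ℂ}
    (hρ : IsSeparableState ρ) (A : Matrix (Fin d1) (Fin d1) ℂ) (B : Matrix (Fin d2) (Fin d2) ℂ) :
    IsSeparableState ((A ⊗ₖ B) * ρ * (A ⊗ₖ B)ᴴ) := by
  obtain ⟨n, p, φ, χ, hp, -, rfl⟩ := hρ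
  have key : ∀ s : Finset (Fin n), IsSeparableState (∑ i ∈ s, (p i : ℂ) •
      productProj (A *ᵥ φ i) (B *ᵥ χ i)) := by
    intro s
    induction s using Finset.induction_on with
    | empty => simpa using IsSeparableState.zero
    | insert i s hi ih =>
      rw [Finset.sum_insert hi]
      exact ((isSeparableState_productProj _ _).smul (hp i)).add ih
  convert key Finset.univ using 1
  rw [Finset.mul_sum, Finset.sum_mul]
  refine Finset.sum_congr rfl fun i _ => ?_
  rw [productProj, Matrix.mul_smul, Matrix.smul_mul, mul_vecMulVec, vecMulVec_mul, ← star_mulVec,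
    kronecker_mulVec_tensorVec]

/-- A local filtering acts on the partial transpose with the conjugate second factor. -/
lemma partialTranspose_kronecker_conj (ρ : Matrix (Fin d1 × Fin d2) (Fin d1 × Fin d2) ℂ)
    (A : Matrix (Fin d1) (Fin d1) ℂ) (B : Matrix (Fin d2) (Fin d2) ℂ) :
    partialTranspose ((A ⊗ₖ B)ᴴ * ρ * (A ⊗ₖ B)) =
      (A ⊗ₖ B.map star)ᴴ * partialTranspose ρ * (A ⊗ₖ B.map star) := by
  ext ⟨i, j⟩ ⟨k, l⟩
  simp only [partialTranspose_apply, mul_apply, Fintype.sum_prod_type, kronecker_apply,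
    conjTranspose_apply, map_apply, Finset.sum_mul, star_mul, star_star]
  refine Finset.sum_congr rfl fun a _ => ?_
  rw [Finset.sum_comm]
  conv_rhs => rw [Finset.sum_comm]
  refine Finset.sum_congr rfl fun b _ => ?_
  rw [Finset.sum_comm]
  refine Finset.sum_congr rfl fun c _ => Finset.sum_congr rfl fun d _ => ?_
  ring

lemma dotProduct_partialTranspose_tensorVec
    (ρ : Matrix (Fin d1 × Fin d2) (Fin d1 × Fin d2) ℂ) (φ : Fin d1 → ℂ) (χ : Fin d2 → ℂ) :
    star (tensorVec φ χ) ⬝ᵥ (partialTranspose ρ *ᵥ tensorVec φ χ) =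
      star (tensorVec φ (star χ)) ⬝ᵥ (ρ *ᵥ tensorVec φ (star χ)) := by
  simp only [dotProduct, mulVec, Fintype.sum_prod_type, partialTranspose_apply, tensorVec,
    Pi.star_apply, star_mul, star_star, Finset.mul_sum]
  refine Finset.sum_congr rfl fun a _ => ?_
  rw [Finset.sum_comm]
  conv_rhs => rw [Finset.sum_comm]
  refine Finset.sum_congr rfl fun b _ => ?_
  rw [Finset.sum_comm]
  refine Finset.sum_congr rfl fun c _ => Finset.sum_congr rfl fun d _ => ?_
  ring

end Separable

section PosSemidef

variable {n : Type*} [Fintype n]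

lemma Matrix.IsHermitian.star_dotProduct_mulVec {R : Matrix n n ℂ} (hR : R.IsHermitian)
    (x y : n → ℂ) : star x ⬝ᵥ (R *ᵥ y) = star (R *ᵥ x) ⬝ᵥ y := by
  rw [star_mulVec, hR.eq, dotProduct_mulVec]

lemma Matrix.IsHermitian.mem_range_mulVec [DecidableEq n] {R : Matrix n n ℂ}
    (hR : R.IsHermitian) {v : n → ℂ}
    (hv : ∀ x, R *ᵥ x = 0 → star x ⬝ᵥ v = 0) : ∃ u, R *ᵥ u = v := by
  have hsym := isSymmetric_toEuclideanLin_iff.mpr hR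
  have hmem : WithLp.toLp 2 v ∈ (LinearMap.ker (toEuclideanLin R))ᗮ := by
    rw [Submodule.mem_orthogonal]
    intro x hx
    have hx' : R *ᵥ WithLp.ofLp x = 0 := by
      simpa [toLpLin_apply] using congrArg WithLp.ofLp (LinearMap.mem_ker.1 hx)
    have := hv _ hx'
    rw [EuclideanSpace.inner_eq_star_dotProduct, dotProduct_comm]
    simpa using this
  rw [← hsym.orthogonal_range, Submodule.orthogonal_orthogonal] at hmem
  obtain ⟨u, hu⟩ := hmem
  refine ⟨WithLp.ofLp u, ?_⟩
  simpa [toLpLin_apply] using congrArg WithLp.ofLp hu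

/-- Subtracting a multiple of a projector onto a vector in the range keeps a matrix positive
semidefinite, as long as the multiple is not too large. -/
lemma Matrix.PosSemidef.sub_smul_vecMulVec {R : Matrix n n ℂ} (hR : R.PosSemidef) (u : n → ℂ)
    {t : ℝ} (ht : 0 ≤ t) (ht' : (t : ℂ) * (star u ⬝ᵥ (R *ᵥ u)) ≤ 1) :
    (R - (t : ℂ) • vecMulVec (R *ᵥ u) (star (R *ᵥ u))).PosSemidef := by
  have hH := hR.isHermitian
  refine .of_dotProduct_mulVec_nonneg (hH.sub ?_) fun x => ?_
  · rw [IsHermitian, conjTranspose_smul, conjTranspose_vecMulVec, star_star]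
    simp
  set c := star u ⬝ᵥ (R *ᵥ x) with hc
  have hc1 : star (R *ᵥ u) ⬝ᵥ x = c := (hH.star_dotProduct_mulVec u x).symm
  have hc2 : star x ⬝ᵥ (R *ᵥ u) = star c := by
    rw [← hc1, ← star_dotProduct_star, star_star, dotProduct_comm]
  have h1 := hR.dotProduct_mulVec_nonneg (x - ((t : ℂ) * c) • u)
  have h2 : 0 ≤ (t : ℂ) * (star c * c) * (1 - (t : ℂ) * (star u ⬝ᵥ (R *ᵥ u))) :=
    mul_nonneg (mul_nonneg (by exact_mod_cast ht) (star_mul_self_nonneg c)) (sub_nonneg.2 ht')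
  have h3 := add_nonneg h1 h2
  simp only [star_sub, star_smul, mulVec_sub, mulVec_smul, sub_dotProduct, dotProduct_sub,
    smul_dotProduct, dotProduct_smul, smul_eq_mul, ← hc, hc2, star_mul', RCLike.star_def,
    Complex.conj_ofReal] at h3
  rw [sub_mulVec, smul_mulVec, vecMulVec_mulVec, dotProduct_sub, dotProduct_smul, hc1]
  simp only [op_smul_eq_smul, dotProduct_smul, smul_eq_mul, hc2, RCLike.star_def]
  convert h3 using 1
  ring

end PosSemidef

section TwoQubit

lemma exists_eq_tensorVec_of_det_eq_zero {v : Fin 2 × Fin 2 → ℂ}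
    (h : v (0, 0) * v (1, 1) = v (0, 1) * v (1, 0)) : ∃ φ χ, v = tensorVec φ χ := by
  by_cases h0 : v (0, 0) = 0
  · by_cases h1 : v (0, 1) = 0
    · refine ⟨![0, 1], ![v (1, 0), v (1, 1)], funext fun ⟨i, j⟩ => ?_⟩
      fin_cases i <;> fin_cases j <;> simp [tensorVec, h0, h1]
    · have h10 : v (1, 0) = 0 := by simpa [h0, h1] using h
      refine ⟨![1, v (1, 1) / v (0, 1)], ![0, v (0, 1)], funext fun ⟨i, j⟩ => ?_⟩
      fin_cases i <;> fin_cases j <;> simp [tensorVec, h0, h1, h10]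
  · refine ⟨![1, v (1, 0) / v (0, 0)], ![v (0, 0), v (0, 1)], funext fun ⟨i, j⟩ => ?_⟩
    fin_cases i <;> fin_cases j <;> simp [tensorVec, h0]
    field_simp
    linear_combination h

/-- Every two-dimensional subspace of `ℂ² ⊗ ℂ²` contains a product vector. -/
lemma exists_tensorVec_eq_smul_add_smul (x y : Fin 2 × Fin 2 → ℂ) :
    ∃ (s t : ℂ) (φ χ : Fin 2 → ℂ), (s ≠ 0 ∨ t ≠ 0) ∧ s • x + t • y = tensorVec φ χ := by
  by_cases hy : y (0, 0) * y (1, 1) - y (0, 1) * y (1, 0) = 0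
  · obtain ⟨φ, χ, h⟩ := exists_eq_tensorVec_of_det_eq_zero (sub_eq_zero.1 hy)
    exact ⟨0, 1, φ, χ, by simp, by simp [h]⟩
  · obtain ⟨t, ht⟩ := exists_quadratic_eq_zero (b := x (0, 0) * y (1, 1) + y (0, 0) * x (1, 1)
      - x (0, 1) * y (1, 0) - y (0, 1) * x (1, 0))
      (c := x (0, 0) * x (1, 1) - x (0, 1) * x (1, 0)) hy (IsAlgClosed.exists_eq_mul_self _)
    obtain ⟨φ, χ, h⟩ := exists_eq_tensorVec_of_det_eq_zero (v := (1 : ℂ) • x + t • y) (by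
      simp only [Pi.add_apply, Pi.smul_apply, smul_eq_mul]
      linear_combination ht)
    exact ⟨1, t, φ, χ, by simp, h⟩

lemma Matrix.PosSemidef.apply_eq_zero_of_diag_eq_zero {n : Type*} [Fintype n] [DecidableEq n]
    {R : Matrix n n ℂ} (hR : R.PosSemidef) {i : n} (hi : R i i = 0) (j : n) : R i j = 0 := by
  have h := (hR.dotProduct_mulVec_zero_iff (Pi.single i 1)).1 (by
    simpa using hi)
  have hj : R j i = 0 := by simpa using congrFun h j
  rw [← hR.isHermitian.apply, hj, star_zero]

/-- A two-qubit state annihilating `|00⟩` whose partial transpose annihilates `|00⟩` is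
separable. -/
lemma isSeparableState_of_ground_ker {ρ : Matrix (Fin 2 × Fin 2) (Fin 2 × Fin 2) ℂ}
    (hρ : ρ.PosSemidef) (h00 : ρ (0, 0) (0, 0) = 0) (h01 : ρ (0, 1) (1, 0) = 0) :
    IsSeparableState ρ := by
  have hrow := fun j => hρ.apply_eq_zero_of_diag_eq_zero h00 j
  have hcol : ∀ j, ρ j (0, 0) = 0 := fun j => by
    rw [← hρ.isHermitian.apply, hrow, star_zero]
  have h10 : ρ (1, 0) (0, 1) = 0 := by rw [← hρ.isHermitian.apply, h01, star_zero]
  obtain ⟨a, ha, ha'⟩ := RCLike.nonneg_iff_exists_ofReal.1 (hρ.diag_nonneg (i := (0, 1)))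
  obtain ⟨c, hc, hc'⟩ := RCLike.nonneg_iff_exists_ofReal.1 (hρ.diag_nonneg (i := (1, 0)))
  obtain ⟨e, he, he'⟩ := RCLike.nonneg_iff_exists_ofReal.1 (hρ.diag_nonneg (i := (1, 1)))
  replace ha' : ρ (0, 1) (0, 1) = (a : ℂ) := ha'.symm
  replace hc' : ρ (1, 0) (1, 0) = (c : ℂ) := hc'.symm
  replace he' : ρ (1, 1) (1, 1) = (e : ℂ) := he'.symm
  obtain ⟨b, hb⟩ : ∃ b, ρ (0, 1) (1, 1) = b := ⟨_, rfl⟩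
  obtain ⟨d, hd⟩ : ∃ d, ρ (1, 0) (1, 1) = d := ⟨_, rfl⟩
  have hb' : ρ (1, 1) (0, 1) = star b := by rw [← hρ.isHermitian.apply, hb]
  have hd' : ρ (1, 1) (1, 0) = star d := by rw [← hρ.isHermitian.apply, hd]
  have hab : a = 0 → b = 0 := fun h => by
    rw [← hb]; exact hρ.apply_eq_zero_of_diag_eq_zero (by simp [ha', h]) _
  have hcd : c = 0 → d = 0 := fun h => by
    rw [← hd]; exact hρ.apply_eq_zero_of_diag_eq_zero (by simp [hc', h]) _
  have hab' : (a : ℂ) * ((a : ℂ)⁻¹ * b) = b := by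
    by_cases h : a = 0
    · simp [hab h]
    · field_simp
  have hcd' : (c : ℂ) * ((c : ℂ)⁻¹ * d) = d := by
    by_cases h : c = 0
    · simp [hcd h]
    · field_simp
  have hf : 0 ≤ e - a⁻¹ * Complex.normSq b - c⁻¹ * Complex.normSq d := by
    have h := hρ.dotProduct_mulVec_nonneg fun p =>
      !![0, -((a : ℂ)⁻¹ * b); -((c : ℂ)⁻¹ * d), 1] p.1 p.2
    have h2 : (0 : ℂ) ≤ ((e - a⁻¹ * Complex.normSq b - c⁻¹ * Complex.normSq d : ℝ) : ℂ) := by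
      convert h using 1
      simp only [dotProduct, mulVec, Fintype.sum_prod_type, Fin.sum_univ_two, Pi.star_apply, hrow,
        hcol, h01, h10, ha', hc', he', hb, hd, hb', hd', Matrix.of_apply, Matrix.cons_val',
        Matrix.cons_val_zero, Matrix.cons_val_one, Matrix.cons_val_fin_one]
      push_cast
      simp only [← Complex.mul_conj, RCLike.star_def, map_neg, map_mul, map_inv₀,
        Complex.conj_ofReal, map_zero, map_one]
      linear_combination -((a : ℂ)⁻¹ * (starRingEnd ℂ) b) * hab' -
        ((c : ℂ)⁻¹ * (starRingEnd ℂ) d) * hcd'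
    exact_mod_cast h2
  have hsep := (((isSeparableState_productProj ![(a : ℂ), star b] ![0, 1]).smul
    (inv_nonneg.2 ha)).add ((isSeparableState_productProj ![0, 1] ![(c : ℂ), star d]).smul
    (inv_nonneg.2 hc))).add ((isSeparableState_productProj ![0, 1] ![0, 1]).smul hf)
  convert hsep
  have haa : (a : ℂ)⁻¹ * (a * a) = a := by
    by_cases h : a = 0
    · simp [h]
    · field_simp
  have hcc : (c : ℂ)⁻¹ * (c * c) = c := by
    by_cases h : c = 0
    · simp [h]
    · field_simp
  have hab'' := congrArg (starRingEnd ℂ) hab'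
  have hcd'' := congrArg (starRingEnd ℂ) hcd'
  simp only [map_mul, map_inv₀, Complex.conj_ofReal] at hab'' hcd''
  ext ⟨i, j⟩ ⟨k, l⟩
  fin_cases i <;> fin_cases j <;> fin_cases k <;> fin_cases l <;>
    simp [productProj, tensorVec, vecMulVec_apply, hrow, hcol, h01, h10, ha', hc', he', hb, hd,
      hb', hd', haa, hcc, ← Complex.mul_conj]
  · linear_combination -hab'
  · linear_combination -hcd'
  · linear_combination -hab''
  · linear_combination -hcd''
  · ring

/-- A matrix with first column `φ` and orthogonal columns. -/
noncomputable def frameMatrix (φ : Fin 2 → ℂ) : Matrix (Fin 2) (Fin 2) ℂ :=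
  !![φ 0, -star (φ 1); φ 1, star (φ 0)]

lemma frameMatrix_mulVec (φ : Fin 2 → ℂ) : frameMatrix φ *ᵥ ![1, 0] = φ := by
  ext i
  fin_cases i <;> simp [frameMatrix, mulVec, dotProduct]

lemma isUnit_det_frameMatrix {φ : Fin 2 → ℂ} (h : φ ≠ 0) : IsUnit (frameMatrix φ).det := by
  rw [isUnit_iff_ne_zero]
  contrapose! h
  have h' : star φ ⬝ᵥ φ = 0 := by
    simp only [frameMatrix, det_fin_two_of] at h
    simp only [dotProduct, Fin.sum_univ_two, Pi.star_apply]
    linear_combination h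
  exact dotProduct_star_self_eq_zero.1 h'

lemma left_ne_zero_of_tensorVec_ne_zero {d1 d2 : ℕ} {φ : Fin d1 → ℂ} {χ : Fin d2 → ℂ}
    (h : tensorVec φ χ ≠ 0) : φ ≠ 0 := by
  rintro rfl
  exact h (by ext; simp [tensorVec])

lemma right_ne_zero_of_tensorVec_ne_zero {d1 d2 : ℕ} {φ : Fin d1 → ℂ} {χ : Fin d2 → ℂ}
    (h : tensorVec φ χ ≠ 0) : χ ≠ 0 := by
  rintro rfl
  exact h (by ext; simp [tensorVec])

lemma tensorVec_ne_zero {d1 d2 : ℕ} {φ : Fin d1 → ℂ} {χ : Fin d2 → ℂ}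
    (hφ : φ ≠ 0) (hχ : χ ≠ 0) : tensorVec φ χ ≠ 0 := by
  obtain ⟨i, hi⟩ := Function.ne_iff.1 hφ
  obtain ⟨j, hj⟩ := Function.ne_iff.1 hχ
  exact fun h => mul_ne_zero hi hj (congrFun h (i, j))

lemma map_star_mulVec_star {d : ℕ} (B : Matrix (Fin d) (Fin d) ℂ) (χ : Fin d → ℂ) :
    B.map star *ᵥ star χ = star (B *ᵥ χ) := by
  ext i
  simp [mulVec, dotProduct]

/-- A two-qubit state annihilating a product vector, with partial transpose annihilating the
partially conjugated product vector, is separable. -/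
lemma isSeparableState_of_tensorVec_mem_ker {ρ : Matrix (Fin 2 × Fin 2) (Fin 2 × Fin 2) ℂ}
    (hρ : ρ.PosSemidef) {φ χ : Fin 2 → ℂ} (h0 : tensorVec φ χ ≠ 0)
    (h1 : ρ *ᵥ tensorVec φ χ = 0) (h2 : partialTranspose ρ *ᵥ tensorVec φ (star χ) = 0) :
    IsSeparableState ρ := by
  set A := frameMatrix φ with hA
  set B := frameMatrix χ with hB
  have hAu := isUnit_det_frameMatrix (left_ne_zero_of_tensorVec_ne_zero h0)
  have hBu := isUnit_det_frameMatrix (right_ne_zero_of_tensorVec_ne_zero h0)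
  have hS : (A ⊗ₖ B) * (A⁻¹ ⊗ₖ B⁻¹) = 1 := by
    rw [← mul_kronecker_mul, mul_nonsing_inv _ hAu, mul_nonsing_inv _ hBu, one_kronecker_one]
  have hground : (tensorVec ![1, 0] ![1, 0] : Fin 2 × Fin 2 → ℂ) = Pi.single (0, 0) 1 := by
    ext ⟨i, j⟩
    fin_cases i <;> fin_cases j <;> simp [tensorVec]
  have h1' : ((A ⊗ₖ B)ᴴ * ρ * (A ⊗ₖ B)) *ᵥ Pi.single (0, 0) 1 = 0 := by
    rw [← hground, ← mulVec_mulVec, kronecker_mulVec_tensorVec, hA, hB, frameMatrix_mulVec,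
      frameMatrix_mulVec, ← mulVec_mulVec, h1, mulVec_zero]
  have h2' : partialTranspose ((A ⊗ₖ B)ᴴ * ρ * (A ⊗ₖ B)) *ᵥ Pi.single (0, 0) 1 = 0 := by
    have hstar : (![1, 0] : Fin 2 → ℂ) = star ![1, 0] := by
      ext i; fin_cases i <;> simp
    rw [partialTranspose_kronecker_conj, ← hground, ← mulVec_mulVec, kronecker_mulVec_tensorVec,
      hA, hB, frameMatrix_mulVec]
    conv_lhs => rw [hstar]
    rw [map_star_mulVec_star, frameMatrix_mulVec, ← mulVec_mulVec, h2, mulVec_zero]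
  have hsep : IsSeparableState ((A ⊗ₖ B)ᴴ * ρ * (A ⊗ₖ B)) := by
    refine isSeparableState_of_ground_ker (hρ.conjTranspose_mul_mul_same _) ?_ ?_
    · simpa using congrFun h1' (0, 0)
    · have h := congrFun h2' (1, 1)
      rw [mulVec_single_one] at h
      have h' : ((A ⊗ₖ B)ᴴ * ρ * (A ⊗ₖ B)) (1, 0) (0, 1) = 0 := h
      rw [← (hρ.conjTranspose_mul_mul_same _).isHermitian.apply, h', star_zero]
  have h := hsep.kronecker_conj (A⁻¹)ᴴ (B⁻¹)ᴴ
  convert h using 1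
  rw [← conjTranspose_kronecker, conjTranspose_conjTranspose]
  calc ρ = ((A ⊗ₖ B) * (A⁻¹ ⊗ₖ B⁻¹))ᴴ * ρ * ((A ⊗ₖ B) * (A⁻¹ ⊗ₖ B⁻¹)) := by simp [hS]
    _ = _ := by simp only [conjTranspose_mul, Matrix.mul_assoc]

/-- The (unnormalized) singlet vector. -/
noncomputable def singletVec : Fin 2 × Fin 2 → ℂ := fun p => !![0, 1; -1, 0] p.1 p.2

/-- If a positive semidefinite operator annihilates the singlet but no product vector, and the
kernel of its partial transpose is one-dimensional, then that kernel is orthogonal to some vector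
`φ ⊗ star φ`. -/
lemma exists_tensorVec_star_orthogonal {ρ : Matrix (Fin 2 × Fin 2) (Fin 2 × Fin 2) ℂ}
    (hρ : ρ.PosSemidef) (hK : ∀ φ χ, ρ *ᵥ tensorVec φ χ = 0 → tensorVec φ χ = 0)
    (hs : ρ *ᵥ singletVec = 0) {η : Fin 2 × Fin 2 → ℂ} (hη : η ≠ 0)
    (hWη : partialTranspose ρ *ᵥ η = 0)
    (hL : ∀ x, partialTranspose ρ *ᵥ x = 0 → ∃ c : ℂ, x = c • η) :
    ∃ φ : Fin 2 → ℂ, φ ≠ 0 ∧ star η ⬝ᵥ tensorVec φ (star φ) = 0 := by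
  have hcol : ∀ x, ρ x (1, 0) = ρ x (0, 1) := fun x => by
    have h := congrFun hs x
    simp [mulVec, dotProduct, Fintype.sum_prod_type, singletVec] at h
    linear_combination -h
  have hrow : ∀ x, ρ (1, 0) x = ρ (0, 1) x := fun x => by
    rw [← hρ.isHermitian.apply, hcol, hρ.isHermitian.apply]
  have hflip : ∀ x, partialTranspose ρ *ᵥ x = 0 →
      partialTranspose ρ *ᵥ (fun p => star (x p.swap)) = 0 := fun x hx => by
    ext ⟨i, j⟩
    have h := congrArg star (congrFun hx (j, i))
    have hswap : ∀ y x, ρ y.swap x = ρ y x := by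
      rintro ⟨i, j⟩ x
      fin_cases i <;> fin_cases j <;> simp [hrow]
    have hswap' : ∀ x y, ρ x y.swap = ρ x y := by
      rintro x ⟨i, j⟩
      fin_cases i <;> fin_cases j <;> simp [hcol]
    simp only [mulVec, dotProduct, star_sum, star_mul', Fintype.sum_prod_type,
      partialTranspose_apply, Pi.zero_apply, star_zero, Prod.swap_prod_mk] at h ⊢
    rw [← h, Finset.sum_comm]
    refine Finset.sum_congr rfl fun k _ => Finset.sum_congr rfl fun l _ => ?_
    rw [hρ.isHermitian.apply, ← hswap (k, i), ← hswap' _ (j, l)]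
    rfl
  obtain ⟨h, hh0, hWh, hherm⟩ : ∃ h : Fin 2 × Fin 2 → ℂ, h ≠ 0 ∧ partialTranspose ρ *ᵥ h = 0 ∧
      ∀ i j, h (j, i) = star (h (i, j)) := by
    by_cases hre : η + (fun p => star (η p.swap)) = 0
    · refine ⟨Complex.I • η, smul_ne_zero Complex.I_ne_zero hη, by
        rw [mulVec_smul, hWη, smul_zero], fun i j => ?_⟩
      have h := congrFun hre (j, i)
      simp only [Pi.add_apply, Prod.swap_prod_mk, Pi.zero_apply] at h
      simp only [Pi.smul_apply, smul_eq_mul, star_mul', RCLike.star_def, Complex.conj_I] at h ⊢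
      linear_combination Complex.I * h
    · refine ⟨_, hre, by rw [mulVec_add, hWη, hflip _ hWη, zero_add], fun i j => ?_⟩
      simp [add_comm]
  obtain ⟨k, hk⟩ := hL h hWh
  have hk0 : k ≠ 0 := by
    rintro rfl
    exact hh0 (by simp [hk])
  suffices hsuff : ∃ φ : Fin 2 → ℂ, φ ≠ 0 ∧ star h ⬝ᵥ tensorVec φ (star φ) = 0 by
    obtain ⟨φ, hφ, hφ'⟩ := hsuff
    refine ⟨φ, hφ, ?_⟩
    rw [hk, star_smul, smul_dotProduct, smul_eq_mul] at hφ'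
    exact (mul_eq_zero.1 hφ').resolve_left (star_ne_zero.2 hk0)
  obtain ⟨p, hp⟩ := Complex.conj_eq_iff_real.1 (hherm 0 0).symm
  obtain ⟨r, hr⟩ := Complex.conj_eq_iff_real.1 (hherm 1 1).symm
  obtain ⟨q, hq⟩ : ∃ q, h (0, 1) = q := ⟨_, rfl⟩
  have hq' : h (1, 0) = star q := by rw [hherm 0 1, hq]
  by_cases hp0 : p = 0
  · refine ⟨![1, 0], fun h => one_ne_zero (congrFun h 0), ?_⟩
    simp [dotProduct, Fintype.sum_prod_type, tensorVec, hp, hp0]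
  have hp0' : (p : ℂ) ≠ 0 := by exact_mod_cast hp0
  rcases le_or_gt 0 (Complex.normSq q - p * r) with hdet | hdet
  · have hsq : ((Real.sqrt (Complex.normSq q - p * r) : ℝ) : ℂ) ^ 2 =
        q * (starRingEnd ℂ) q - p * r := by
      rw [← Complex.ofReal_pow, Real.sq_sqrt hdet, Complex.mul_conj]
      push_cast
      rfl
    set s := Real.sqrt (Complex.normSq q - p * r)
    refine ⟨![(s - q) / p, 1], fun h => one_ne_zero (congrFun h 1), ?_⟩
    simp only [dotProduct, Fintype.sum_prod_type, Fin.sum_univ_two, tensorVec, Pi.star_apply, hp,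
      hq, hq', hr, Matrix.cons_val_zero, Matrix.cons_val_one, RCLike.star_def, map_div₀, map_sub,
      map_one, Complex.conj_ofReal, Complex.conj_conj, Matrix.cons_val_fin_one]
    field_simp
    linear_combination hsq
  · exfalso
    set δ := p * r - Complex.normSq q with hδ
    have hδ0 : 0 < δ := by linarith
    have hδc : (δ : ℂ) = p * r - q * (starRingEnd ℂ) q := by
      rw [hδ, Complex.mul_conj]
      push_cast
      rfl
    set g : Fin 2 → ℂ := ![(p : ℂ), star q]
    set e : Fin 2 → ℂ := ![0, 1]
    have hδ0' : (0 : ℂ) ≤ δ := by exact_mod_cast hδ0.le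
    have hQ := fun x => hρ.dotProduct_mulVec_nonneg x
    have hsum : (p : ℂ) ^ 2 * (star h ⬝ᵥ (partialTranspose ρ *ᵥ h)) =
        star (tensorVec g g) ⬝ᵥ (ρ *ᵥ tensorVec g g) +
        δ * (star (tensorVec g e) ⬝ᵥ (ρ *ᵥ tensorVec g e)) +
        δ * (star (tensorVec e g) ⬝ᵥ (ρ *ᵥ tensorVec e g)) +
        δ ^ 2 * (star (tensorVec e e) ⬝ᵥ (ρ *ᵥ tensorVec e e)) := by
      simp only [dotProduct, mulVec, Fintype.sum_prod_type, Fin.sum_univ_two, tensorVec,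
        partialTranspose_apply, Pi.star_apply, hp, hq, hq', hr, hrow, hcol, g, e, hδc,
        Matrix.cons_val_zero, Matrix.cons_val_one, RCLike.star_def, map_mul, map_zero,
        map_one, Complex.conj_ofReal, Complex.conj_conj, Matrix.cons_val_fin_one]
      ring
    rw [hWh, dotProduct_zero, mul_zero] at hsum
    have hgg : star (tensorVec g g) ⬝ᵥ (ρ *ᵥ tensorVec g g) = 0 := by
      refine le_antisymm ?_ (hQ _)
      have h1 := add_nonneg (add_nonneg (mul_nonneg hδ0' (hQ (tensorVec g e)))
        (mul_nonneg hδ0' (hQ (tensorVec e g))))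
        (mul_nonneg (pow_nonneg hδ0' 2) (hQ (tensorVec e e)))
      have h2 := neg_nonpos.2 h1
      convert h2 using 1
      linear_combination -hsum
    have hg := hK g g ((hρ.dotProduct_mulVec_zero_iff _).1 hgg)
    have := congrFun hg (0, 0)
    simp [tensorVec, g, hp0] at this

lemma star_mulVec_dotProduct {n : Type*} [Fintype n] (S : Matrix n n ℂ) (x y : n → ℂ) :
    star (S *ᵥ x) ⬝ᵥ y = star x ⬝ᵥ (Sᴴ *ᵥ y) := by
  rw [star_mulVec, dotProduct_mulVec]

/-- If a positive semidefinite operator annihilates no product vector and `η` spans the kernel of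
its partial transpose, then for every kernel vector `ψ` some product vector is orthogonal to `ψ`
while its partial conjugate is orthogonal to `η`. -/
lemma exists_tensorVec_orthogonal {ρ : Matrix (Fin 2 × Fin 2) (Fin 2 × Fin 2) ℂ}
    (hρ : ρ.PosSemidef) (hK : ∀ φ χ, ρ *ᵥ tensorVec φ χ = 0 → tensorVec φ χ = 0)
    {ψ : Fin 2 × Fin 2 → ℂ} (hψ : ψ ≠ 0) (hρψ : ρ *ᵥ ψ = 0)
    {η : Fin 2 × Fin 2 → ℂ} (hη : η ≠ 0) (hWη : partialTranspose ρ *ᵥ η = 0)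
    (hL : ∀ x, partialTranspose ρ *ᵥ x = 0 → ∃ c : ℂ, x = c • η) :
    ∃ φ χ : Fin 2 → ℂ, tensorVec φ χ ≠ 0 ∧ star ψ ⬝ᵥ tensorVec φ χ = 0 ∧
      star η ⬝ᵥ tensorVec φ (star χ) = 0 := by
  set B : Matrix (Fin 2) (Fin 2) ℂ := !![-ψ (1, 0), ψ (0, 0); -ψ (1, 1), ψ (0, 1)] with hB
  have hBu : IsUnit B.det := by
    rw [isUnit_iff_ne_zero]
    intro h
    rw [hB, det_fin_two_of] at h
    obtain ⟨φ, χ, rfl⟩ := exists_eq_tensorVec_of_det_eq_zero (v := ψ) (by linear_combination h)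
    exact hψ (hK φ χ hρψ)
  set S : Matrix (Fin 2 × Fin 2) (Fin 2 × Fin 2) ℂ := 1 ⊗ₖ B with hS
  set T : Matrix (Fin 2 × Fin 2) (Fin 2 × Fin 2) ℂ := 1 ⊗ₖ B.map star with hT
  have hBs : IsUnit (B.map star).det := by
    have h : (B.map star).det = star B.det := by
      rw [← det_conjTranspose, ← det_transpose]
      rfl
    rw [h]
    exact hBu.star
  have hSu : IsUnit S.det := by
    rw [hS, det_kronecker]
    exact ((by simp : IsUnit (1 : Matrix (Fin 2) (Fin 2) ℂ).det).pow _).mul (hBu.pow _)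
  have hTu : IsUnit T.det := by
    rw [hT, det_kronecker]
    exact ((by simp : IsUnit (1 : Matrix (Fin 2) (Fin 2) ℂ).det).pow _).mul (hBs.pow _)
  have hSs : S *ᵥ singletVec = ψ := by
    ext ⟨i, j⟩
    fin_cases i <;> fin_cases j <;>
      simp [hS, hB, mulVec, dotProduct, Fintype.sum_prod_type, singletVec]
  have hker : ∀ (M : Matrix (Fin 2 × Fin 2) (Fin 2 × Fin 2) ℂ), IsUnit M.det →
      ∀ (R : Matrix (Fin 2 × Fin 2) (Fin 2 × Fin 2) ℂ) x, (Mᴴ * R * M) *ᵥ x = 0 →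
      R *ᵥ (M *ᵥ x) = 0 := by
    intro M hM R x hx
    have hM' : IsUnit Mᴴ := by
      rw [isUnit_iff_isUnit_det, det_conjTranspose]
      exact hM.star
    refine mulVec_injective_of_isUnit hM' ?_
    simpa [mulVec_mulVec, Matrix.mul_assoc] using hx
  have hpt : partialTranspose (Sᴴ * ρ * S) = Tᴴ * partialTranspose ρ * T :=
    partialTranspose_kronecker_conj ρ 1 B
  have hTη : T *ᵥ (T⁻¹ *ᵥ η) = η := by
    rw [mulVec_mulVec, mul_nonsing_inv _ hTu, one_mulVec]
  obtain ⟨φ, hφ, hφη⟩ := exists_tensorVec_star_orthogonal (ρ := Sᴴ * ρ * S)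
    (hρ.conjTranspose_mul_mul_same S)
    (fun φ χ h => by
      have h1 := hker S hSu ρ _ h
      rw [hS, kronecker_mulVec_tensorVec] at h1
      have h2 := hK _ _ h1
      rw [← kronecker_mulVec_tensorVec, ← hS] at h2
      refine mulVec_injective_of_isUnit ((isUnit_iff_isUnit_det _).2 hSu) ?_
      simpa using h2)
    (by rw [← mulVec_mulVec, hSs, ← mulVec_mulVec, hρψ, mulVec_zero])
    (η := T⁻¹ *ᵥ η)
    (fun h => hη (by rw [← hTη, h, mulVec_zero]))
    (by rw [hpt, ← mulVec_mulVec, hTη, ← mulVec_mulVec, hWη, mulVec_zero])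
    (fun x hx => by
      rw [hpt] at hx
      obtain ⟨c, hc⟩ := hL _ (hker T hTu _ _ hx)
      refine ⟨c, ?_⟩
      rw [← mulVec_smul, ← hc, mulVec_mulVec, nonsing_inv_mul _ hTu, one_mulVec])
  have hBh : IsUnit (Bᴴ).det := by
    rw [det_conjTranspose]
    exact hBu.star
  have hBχ : Bᴴ *ᵥ ((Bᴴ)⁻¹ *ᵥ φ) = φ := by
    rw [mulVec_mulVec, mul_nonsing_inv _ hBh, one_mulVec]
  have hχ0 : (Bᴴ)⁻¹ *ᵥ φ ≠ 0 := fun h => hφ (by rw [← hBχ, h, mulVec_zero])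
  refine ⟨φ, (Bᴴ)⁻¹ *ᵥ φ, tensorVec_ne_zero hφ hχ0, ?_, ?_⟩
  · rw [← hSs, star_mulVec_dotProduct, hS, conjTranspose_kronecker, kronecker_mulVec_tensorVec,
      hBχ, conjTranspose_one, one_mulVec]
    simp [dotProduct, Fintype.sum_prod_type, singletVec, tensorVec]
    ring
  · rw [← hTη, star_mulVec_dotProduct, hT, conjTranspose_kronecker, kronecker_mulVec_tensorVec,
      conjTranspose_one, one_mulVec, show (B.map star)ᴴ = Bᴴ.map star from rfl,
      map_star_mulVec_star, hBχ]
    exact hφη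

lemma exists_tensorVec_basis_orthogonal (η : Fin 2 × Fin 2 → ℂ) :
    ∃ χ : Fin 2 → ℂ, χ ≠ 0 ∧ star η ⬝ᵥ tensorVec ![1, 0] χ = 0 := by
  by_cases h : η (0, 0) = 0
  · refine ⟨![1, 0], fun h => one_ne_zero (congrFun h 0), ?_⟩
    simp [dotProduct, Fintype.sum_prod_type, tensorVec, h]
  · refine ⟨![-star (η (0, 1)), star (η (0, 0))], fun h' => h ?_, ?_⟩
    · simpa using congrFun h' 1
    · simp [dotProduct, Fintype.sum_prod_type, tensorVec]
      ring

lemma eq_smul_of_no_tensorVec_mem_ker {R : Matrix (Fin 2 × Fin 2) (Fin 2 × Fin 2) ℂ}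
    (hK : ∀ φ χ, R *ᵥ tensorVec φ χ = 0 → tensorVec φ χ = 0) {η : Fin 2 × Fin 2 → ℂ}
    (hη : η ≠ 0) (hRη : R *ᵥ η = 0) (x : Fin 2 × Fin 2 → ℂ) (hx : R *ᵥ x = 0) :
    ∃ c : ℂ, x = c • η := by
  obtain ⟨s, t, φ, χ, hst, h⟩ := exists_tensorVec_eq_smul_add_smul x η
  have h0 : s • x + t • η = 0 := by
    rw [h]
    apply hK
    rw [← h, mulVec_add, mulVec_smul, mulVec_smul, hx, hRη]
    simp
  have hs : s ≠ 0 := by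
    rintro rfl
    simp_all
  refine ⟨-(s⁻¹ * t), ?_⟩
  rw [neg_smul, mul_smul, ← smul_neg, ← eq_neg_of_add_eq_zero_left h0, smul_smul,
    inv_mul_cancel₀ hs, one_smul]

lemma tensorVec_star_ne_zero {d1 d2 : ℕ} {φ : Fin d1 → ℂ} {χ : Fin d2 → ℂ}
    (h : tensorVec φ χ ≠ 0) : tensorVec φ (star χ) ≠ 0 :=
  tensorVec_ne_zero (left_ne_zero_of_tensorVec_ne_zero h)
    (star_ne_zero.2 (right_ne_zero_of_tensorVec_ne_zero h))

/-- If neither a positive semidefinite operator nor its partial transpose annihilates a product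
vector, then some product vector is orthogonal to the kernel of the former while its partial
conjugate is orthogonal to the kernel of the latter. -/
lemma exists_tensorVec_orthogonal_ker {ρ : Matrix (Fin 2 × Fin 2) (Fin 2 × Fin 2) ℂ}
    (hρ : ρ.PosSemidef)
    (hK : ∀ φ χ, ρ *ᵥ tensorVec φ χ = 0 → tensorVec φ χ = 0)
    (hL : ∀ φ χ, partialTranspose ρ *ᵥ tensorVec φ χ = 0 → tensorVec φ χ = 0) :
    ∃ φ χ : Fin 2 → ℂ, tensorVec φ χ ≠ 0 ∧ (∀ x, ρ *ᵥ x = 0 → star x ⬝ᵥ tensorVec φ χ = 0) ∧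
      ∀ x, partialTranspose ρ *ᵥ x = 0 → star x ⬝ᵥ tensorVec φ (star χ) = 0 := by
  have hspan : ∀ (R : Matrix (Fin 2 × Fin 2) (Fin 2 × Fin 2) ℂ) (η v : Fin 2 × Fin 2 → ℂ),
      (∀ x, R *ᵥ x = 0 → ∃ c : ℂ, x = c • η) → star η ⬝ᵥ v = 0 →
      ∀ x, R *ᵥ x = 0 → star x ⬝ᵥ v = 0 := by
    intro R η v hR hv x hx
    obtain ⟨c, rfl⟩ := hR x hx
    rw [star_smul, smul_dotProduct, hv, smul_zero]
  have hone : (![1, 0] : Fin 2 → ℂ) ≠ 0 := fun h => one_ne_zero (congrFun h 0)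
  by_cases h1 : ∃ ψ, ψ ≠ 0 ∧ ρ *ᵥ ψ = 0
  · obtain ⟨ψ, hψ, hρψ⟩ := h1
    have hψs := eq_smul_of_no_tensorVec_mem_ker hK hψ hρψ
    by_cases h2 : ∃ η, η ≠ 0 ∧ partialTranspose ρ *ᵥ η = 0
    · obtain ⟨η, hη, hWη⟩ := h2
      have hηs := eq_smul_of_no_tensorVec_mem_ker hL hη hWη
      obtain ⟨φ, χ, h0, ha, hb⟩ := exists_tensorVec_orthogonal hρ hK hψ hρψ hη hWη hηs
      exact ⟨φ, χ, h0, hspan _ _ _ hψs ha, hspan _ _ _ hηs hb⟩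
    · push Not at h2
      obtain ⟨χ, hχ, ha⟩ := exists_tensorVec_basis_orthogonal ψ
      refine ⟨_, χ, tensorVec_ne_zero hone hχ, hspan _ _ _ hψs ha, fun x hx => ?_⟩
      by_cases hx0 : x = 0
      · simp [hx0]
      · exact absurd hx (h2 x hx0)
  · push Not at h1
    have hx1 : ∀ v x, ρ *ᵥ x = 0 → star x ⬝ᵥ v = 0 := fun v x hx => by
      by_cases hx0 : x = 0
      · simp [hx0]
      · exact absurd hx (h1 x hx0)
    have hηs : ∃ η, ∀ x, partialTranspose ρ *ᵥ x = 0 → ∃ c : ℂ, x = c • η := by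
      by_cases h2 : ∃ η, η ≠ 0 ∧ partialTranspose ρ *ᵥ η = 0
      · obtain ⟨η, hη, hWη⟩ := h2
        exact ⟨η, eq_smul_of_no_tensorVec_mem_ker hL hη hWη⟩
      · push Not at h2
        exact ⟨0, fun x hx => ⟨0, by by_contra h; exact h2 x (by simpa using h) hx⟩⟩
    obtain ⟨η, hηs⟩ := hηs
    obtain ⟨χ, hχ, ha⟩ := exists_tensorVec_basis_orthogonal η
    refine ⟨_, star χ, tensorVec_ne_zero hone (star_ne_zero.2 hχ), hx1 _, ?_⟩
    rw [star_star]
    exact hspan _ _ _ hηs ha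

lemma mulVec_sub_smul_vecMulVec {n : Type*} [Fintype n] (R : Matrix n n ℂ) (u x : n → ℂ) (t : ℂ) :
    (R - t • vecMulVec (R *ᵥ u) (star (R *ᵥ u))) *ᵥ x =
      R *ᵥ x - (t * (star (R *ᵥ u) ⬝ᵥ x)) • (R *ᵥ u) := by
  rw [sub_mulVec, smul_mulVec, vecMulVec_mulVec, op_smul_eq_smul, smul_smul]

lemma Matrix.IsHermitian.ker_le_ker_sub_smul_vecMulVec {n : Type*} [Fintype n]
    {R : Matrix n n ℂ} (hR : R.IsHermitian) (u : n → ℂ) (t : ℂ) :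
    LinearMap.ker R.mulVecLin ≤
      LinearMap.ker (R - t • vecMulVec (R *ᵥ u) (star (R *ᵥ u))).mulVecLin := by
  intro x hx
  rw [LinearMap.mem_ker, mulVecLin_apply] at hx ⊢
  rw [mulVec_sub_smul_vecMulVec, ← hR.star_dotProduct_mulVec, hx]
  simp

lemma Matrix.IsHermitian.ker_lt_ker_sub_smul_vecMulVec {n : Type*} [Fintype n]
    {R : Matrix n n ℂ} (hR : R.IsHermitian) {u : n → ℂ} (hu : R *ᵥ u ≠ 0) {t : ℂ}
    (ht : t * (star u ⬝ᵥ (R *ᵥ u)) = 1) :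
    LinearMap.ker R.mulVecLin <
      LinearMap.ker (R - t • vecMulVec (R *ᵥ u) (star (R *ᵥ u))).mulVecLin := by
  refine lt_of_le_of_ne (hR.ker_le_ker_sub_smul_vecMulVec u t) fun h => hu ?_
  have hmem : u ∈ LinearMap.ker (R - t • vecMulVec (R *ᵥ u) (star (R *ᵥ u))).mulVecLin := by
    rw [LinearMap.mem_ker, mulVecLin_apply, mulVec_sub_smul_vecMulVec,
      ← hR.star_dotProduct_mulVec, ht, one_smul, sub_self]
  rwa [← h] at hmem

lemma Matrix.PosSemidef.exists_pos_dotProduct_mulVec {n : Type*} [Fintype n]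
    {R : Matrix n n ℂ} (hR : R.PosSemidef) {u : n → ℂ} (hu : R *ᵥ u ≠ 0) :
    ∃ α : ℝ, 0 < α ∧ star u ⬝ᵥ (R *ᵥ u) = (α : ℂ) := by
  have hpos : 0 < star u ⬝ᵥ (R *ᵥ u) :=
    lt_of_le_of_ne (hR.dotProduct_mulVec_nonneg u)
      fun h => hu ((hR.dotProduct_mulVec_zero_iff u).1 h.symm)
  obtain ⟨α, hα, h⟩ := RCLike.pos_iff_exists_ofReal.1 hpos
  exact ⟨α, hα, h.symm⟩

lemma partialTranspose_mulVec_tensorVec_star_eq_zero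
    {ρ : Matrix (Fin 2 × Fin 2) (Fin 2 × Fin 2) ℂ} (hW : (partialTranspose ρ).PosSemidef)
    {φ χ : Fin 2 → ℂ} (h : ρ *ᵥ tensorVec φ χ = 0) :
    partialTranspose ρ *ᵥ tensorVec φ (star χ) = 0 := by
  refine (hW.dotProduct_mulVec_zero_iff _).1 ?_
  rw [dotProduct_partialTranspose_tensorVec, star_star, h, dotProduct_zero]

/-- The Peres–Horodecki criterion: a two-qubit positive semidefinite operator with positive
semidefinite partial transpose is separable. -/
theorem isSeparableState_of_partialTranspose_posSemidef
    (ρ : Matrix (Fin 2 × Fin 2) (Fin 2 × Fin 2) ℂ)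
    (hρ : ρ.PosSemidef) (hW : (partialTranspose ρ).PosSemidef) : IsSeparableState ρ := by
  induction hm : 8 - (Module.finrank ℂ (LinearMap.ker ρ.mulVecLin) +
    Module.finrank ℂ (LinearMap.ker (partialTranspose ρ).mulVecLin))
    using Nat.strong_induction_on generalizing ρ with
  | _ m ih =>
  by_cases hK : ∀ φ χ, ρ *ᵥ tensorVec φ χ = 0 → tensorVec φ χ = 0
  swap
  · push Not at hK
    obtain ⟨φ, χ, h1, h0⟩ := hK
    exact isSeparableState_of_tensorVec_mem_ker hρ h0 h1
      (partialTranspose_mulVec_tensorVec_star_eq_zero hW h1)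
  have hL : ∀ φ χ, partialTranspose ρ *ᵥ tensorVec φ χ = 0 → tensorVec φ χ = 0 := by
    intro φ χ h
    by_contra h0
    exact tensorVec_star_ne_zero h0
      (hK _ _ (partialTranspose_mulVec_tensorVec_star_eq_zero (ρ := partialTranspose ρ) hρ h))
  obtain ⟨φ, χ, h0, h1, h2⟩ := exists_tensorVec_orthogonal_ker hρ hK hL
  obtain ⟨u, hu⟩ := hρ.isHermitian.mem_range_mulVec h1
  obtain ⟨w, hw⟩ := hW.isHermitian.mem_range_mulVec h2
  have hu0 : ρ *ᵥ u ≠ 0 := by rwa [hu]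
  have hw0 : partialTranspose ρ *ᵥ w ≠ 0 := by
    rw [hw]
    exact tensorVec_star_ne_zero h0
  obtain ⟨α, hα, hα'⟩ := hρ.exists_pos_dotProduct_mulVec hu0
  obtain ⟨β, hβ, hβ'⟩ := hW.exists_pos_dotProduct_mulVec hw0
  set t := min α⁻¹ β⁻¹ with ht
  have ht0 : 0 ≤ t := le_min (inv_nonneg.2 hα.le) (inv_nonneg.2 hβ.le)
  have htα : t * α ≤ 1 := by
    calc t * α ≤ α⁻¹ * α := by gcongr; exact min_le_left _ _
      _ = 1 := inv_mul_cancel₀ hα.ne'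
  have htβ : t * β ≤ 1 := by
    calc t * β ≤ β⁻¹ * β := by gcongr; exact min_le_right _ _
      _ = 1 := inv_mul_cancel₀ hβ.ne'
  have hP : productProj φ χ = vecMulVec (ρ *ᵥ u) (star (ρ *ᵥ u)) := by rw [hu, productProj]
  have hQ : partialTranspose (ρ - (t : ℂ) • productProj φ χ) = partialTranspose ρ -
      (t : ℂ) • vecMulVec (partialTranspose ρ *ᵥ w) (star (partialTranspose ρ *ᵥ w)) := by
    rw [hw, ← productProj, ← partialTranspose_productProj]
    rfl
  have hρ' : (ρ - (t : ℂ) • productProj φ χ).PosSemidef := by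
    rw [hP]
    exact hρ.sub_smul_vecMulVec u ht0 (by rw [hα']; exact_mod_cast htα)
  have hW' : (partialTranspose (ρ - (t : ℂ) • productProj φ χ)).PosSemidef := by
    rw [hQ]
    exact hW.sub_smul_vecMulVec w ht0 (by rw [hβ']; exact_mod_cast htβ)
  have hle1 : LinearMap.ker ρ.mulVecLin ≤
      LinearMap.ker (ρ - (t : ℂ) • productProj φ χ).mulVecLin := by
    rw [hP]
    exact hρ.isHermitian.ker_le_ker_sub_smul_vecMulVec u _
  have hle2 : LinearMap.ker (partialTranspose ρ).mulVecLin ≤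
      LinearMap.ker (partialTranspose (ρ - (t : ℂ) • productProj φ χ)).mulVecLin := by
    rw [hQ]
    exact hW.isHermitian.ker_le_ker_sub_smul_vecMulVec w _
  have hlt : LinearMap.ker ρ.mulVecLin <
      LinearMap.ker (ρ - (t : ℂ) • productProj φ χ).mulVecLin ∨
      LinearMap.ker (partialTranspose ρ).mulVecLin <
      LinearMap.ker (partialTranspose (ρ - (t : ℂ) • productProj φ χ)).mulVecLin := by
    rcases min_choice α⁻¹ β⁻¹ with h | h
    · left
      rw [hP]
      refine hρ.isHermitian.ker_lt_ker_sub_smul_vecMulVec hu0 ?_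
      rw [hα', ht, h]
      exact_mod_cast inv_mul_cancel₀ hα.ne'
    · right
      rw [hQ]
      refine hW.isHermitian.ker_lt_ker_sub_smul_vecMulVec hw0 ?_
      rw [hβ', ht, h]
      exact_mod_cast inv_mul_cancel₀ hβ.ne'
  have hd : ∀ V : Submodule ℂ (Fin 2 × Fin 2 → ℂ), Module.finrank ℂ V ≤ 4 := fun V => by
    simpa using V.finrank_le
  have hf1 := Submodule.finrank_mono hle1
  have hf2 := Submodule.finrank_mono hle2
  have hd1 := hd (LinearMap.ker (ρ - (t : ℂ) • productProj φ χ).mulVecLin)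
  have hd2 := hd (LinearMap.ker (partialTranspose (ρ - (t : ℂ) • productProj φ χ)).mulVecLin)
  have hsep : IsSeparableState (ρ - (t : ℂ) • productProj φ χ) := by
    refine ih _ ?_ _ hρ' hW' rfl
    rcases hlt with h | h
    · have := Submodule.finrank_lt_finrank_of_lt h
      omega
    · have := Submodule.finrank_lt_finrank_of_lt h
      omega
  have h := hsep.add ((isSeparableState_productProj φ χ).smul ht0)
  rwa [sub_add_cancel] at h

end TwoQubit

section Signature

variable {n : Type*} [Fintype n] [DecidableEq n]

lemma Matrix.IsHermitian.linearIndependent_eigenvectorBasis {W : Matrix n n ℂ}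
    (hW : W.IsHermitian) :
    LinearIndependent ℂ fun i => WithLp.ofLp (hW.eigenvectorBasis i) := by
  simpa [Function.comp_def] using hW.eigenvectorBasis.toBasis.linearIndependent.map'
    (WithLp.linearEquiv 2 ℂ (n → ℂ)).toLinearMap (LinearEquiv.ker _)

lemma Matrix.IsHermitian.iSup_eigenspace_eq_span {W : Matrix n n ℂ} (hW : W.IsHermitian)
    (P : ℝ → Prop) :
    (⨆ (μ : ℝ) (_ : P μ), Module.End.eigenspace (toLin' W) (μ : ℂ)) =
      Submodule.span ℂ (Set.range fun i : {i // P (hW.eigenvalues i)} =>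
        WithLp.ofLp (hW.eigenvectorBasis i)) := by
  apply le_antisymm
  · refine iSup₂_le fun μ hμ x hx => ?_
    rw [Module.End.mem_eigenspace_iff, toLin'_apply] at hx
    have hsum : x = ∑ i, hW.eigenvectorBasis.repr (WithLp.toLp 2 x) i •
        WithLp.ofLp (hW.eigenvectorBasis i) := by
      simpa using (congrArg WithLp.ofLp (hW.eigenvectorBasis.sum_repr (WithLp.toLp 2 x))).symm
    set c := fun i => hW.eigenvectorBasis.repr (WithLp.toLp 2 x) i
    have hzero : ∑ i, (c i * (hW.eigenvalues i - μ)) • WithLp.ofLp (hW.eigenvectorBasis i) = 0 := by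
      have h1 : W *ᵥ x = ∑ i, (c i * hW.eigenvalues i) •
          WithLp.ofLp (hW.eigenvectorBasis i) := by
        conv_lhs => rw [hsum]
        rw [mulVec_sum]
        refine Finset.sum_congr rfl fun i _ => ?_
        rw [mulVec_smul, hW.mulVec_eigenvectorBasis, mul_smul]
        rfl
      simp only [mul_sub, sub_smul, Finset.sum_sub_distrib]
      rw [← h1, hx, sub_eq_zero]
      conv_lhs => rw [hsum]
      rw [Finset.smul_sum]
      exact Finset.sum_congr rfl fun i _ => by rw [smul_smul, mul_comm]
    have hc := Fintype.linearIndependent_iff.1 hW.linearIndependent_eigenvectorBasis _ hzero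
    rw [hsum]
    refine Submodule.sum_mem _ fun i _ => ?_
    rcases mul_eq_zero.1 (hc i) with h | h
    · change c i • _ ∈ _
      rw [h, zero_smul]
      exact Submodule.zero_mem _
    · have hi : hW.eigenvalues i = μ := by exact_mod_cast sub_eq_zero.1 h
      exact Submodule.smul_mem _ _ (Submodule.subset_span ⟨⟨i, hi ▸ hμ⟩, rfl⟩)
  · rw [Submodule.span_le]
    rintro _ ⟨⟨i, hi⟩, rfl⟩
    refine Submodule.mem_iSup_of_mem (hW.eigenvalues i) (Submodule.mem_iSup_of_mem hi ?_)
    rw [Module.End.mem_eigenspace_iff, toLin'_apply, hW.mulVec_eigenvectorBasis]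
    rfl

lemma Matrix.IsHermitian.finrank_iSup_eigenspace {W : Matrix n n ℂ} (hW : W.IsHermitian)
    (P : ℝ → Prop) [DecidablePred P] :
    Module.finrank ℂ (⨆ (μ : ℝ) (_ : P μ), Module.End.eigenspace (toLin' W) (μ : ℂ) :
      Submodule ℂ (n → ℂ)) = (Finset.univ.filter fun i => P (hW.eigenvalues i)).card := by
  rw [hW.iSup_eigenspace_eq_span P, ← Fintype.card_subtype]
  exact finrank_span_eq_card
    (hW.linearIndependent_eigenvectorBasis.comp _ Subtype.val_injective)

end Signature

/-- The partial transpose of an entangled two-qubit state has at most one nonpositive eigenvalue,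
counted with multiplicity. -/
lemma card_eigenvalues_nonpos_le_one {ρ : Matrix (Fin 2 × Fin 2) (Fin 2 × Fin 2) ℂ}
    (hρ : ρ.PosSemidef) (hent : ¬ IsSeparableState ρ) (hW : (partialTranspose ρ).IsHermitian) :
    (Finset.univ.filter fun i => hW.eigenvalues i ≤ 0).card ≤ 1 := by
  rw [Finset.card_le_one]
  intro i hi j hj
  by_contra hij
  simp only [Finset.mem_filter, Finset.mem_univ, true_and] at hi hj
  set x := WithLp.ofLp (hW.eigenvectorBasis i) with hx
  set y := WithLp.ofLp (hW.eigenvectorBasis j) with hy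
  have hWx : partialTranspose ρ *ᵥ x = (hW.eigenvalues i : ℂ) • x := hW.mulVec_eigenvectorBasis i
  have hWy : partialTranspose ρ *ᵥ y = (hW.eigenvalues j : ℂ) • y := hW.mulVec_eigenvectorBasis j
  have hin : ∀ k l, star (WithLp.ofLp (hW.eigenvectorBasis k)) ⬝ᵥ
      WithLp.ofLp (hW.eigenvectorBasis l) = if k = l then 1 else 0 := fun k l => by
    rw [← orthonormal_iff_ite.1 hW.eigenvectorBasis.orthonormal k l,
      EuclideanSpace.inner_eq_star_dotProduct, dotProduct_comm]
  have hxx : star x ⬝ᵥ x = 1 := by rw [hx, hin, if_pos rfl]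
  have hyy : star y ⬝ᵥ y = 1 := by rw [hy, hin, if_pos rfl]
  have hxy : star x ⬝ᵥ y = 0 := by rw [hx, hy, hin, if_neg hij]
  have hyx : star y ⬝ᵥ x = 0 := by rw [hx, hy, hin, if_neg (Ne.symm hij)]
  obtain ⟨s, t, φ, χ, hst, hv⟩ := exists_tensorVec_eq_smul_add_smul x y
  have hWv : partialTranspose ρ *ᵥ tensorVec φ χ =
      (s * hW.eigenvalues i) • x + (t * hW.eigenvalues j) • y := by
    rw [← hv, mulVec_add, mulVec_smul, mulVec_smul, hWx, hWy, smul_smul, smul_smul]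
  have hq : star (tensorVec φ χ) ⬝ᵥ (partialTranspose ρ *ᵥ tensorVec φ χ) =
      ((Complex.normSq s * hW.eigenvalues i + Complex.normSq t * hW.eigenvalues j : ℝ) : ℂ) := by
    rw [hWv, ← hv]
    simp only [star_add, star_smul, add_dotProduct, dotProduct_add, smul_dotProduct,
      dotProduct_smul, hxx, hyy, hxy, hyx, smul_eq_mul, RCLike.star_def]
    push_cast
    rw [← Complex.mul_conj, ← Complex.mul_conj]
    ring
  have hnonneg := hρ.dotProduct_mulVec_nonneg (tensorVec φ (star χ))
  rw [← dotProduct_partialTranspose_tensorVec, hq] at hnonneg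
  have hnonneg' : 0 ≤ Complex.normSq s * hW.eigenvalues i +
      Complex.normSq t * hW.eigenvalues j := by exact_mod_cast hnonneg
  have hs := mul_nonpos_of_nonneg_of_nonpos (Complex.normSq_nonneg s) hi
  have ht := mul_nonpos_of_nonneg_of_nonpos (Complex.normSq_nonneg t) hj
  have hs0 : s * (hW.eigenvalues i : ℂ) = 0 := by
    have h : Complex.normSq s * hW.eigenvalues i = 0 := by linarith
    simpa using h
  have ht0 : t * (hW.eigenvalues j : ℂ) = 0 := by
    have h : Complex.normSq t * hW.eigenvalues j = 0 := by linarith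
    simpa using h
  have hWv0 : partialTranspose ρ *ᵥ tensorVec φ χ = 0 := by
    rw [hWv, hs0, ht0, zero_smul, zero_smul, add_zero]
  have hne : tensorVec φ χ ≠ 0 := by
    intro h
    rw [← hv] at h
    have h1 := congrArg (star x ⬝ᵥ ·) h
    have h2 := congrArg (star y ⬝ᵥ ·) h
    simp only [dotProduct_add, dotProduct_smul, hxx, hyy, hxy, hyx, smul_eq_mul, mul_one, mul_zero,
      add_zero, zero_add, dotProduct_zero] at h1 h2
    exact hst.elim (· h1) (· h2)
  have hρv : ρ *ᵥ tensorVec φ (star χ) = 0 :=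
    partialTranspose_mulVec_tensorVec_star_eq_zero (ρ := partialTranspose ρ) hρ hWv0
  exact hent (isSeparableState_of_tensorVec_mem_ker hρ (tensorVec_star_ne_zero hne) hρv
    (by rwa [star_star]))

/-- The partial transpose of an entangled positive semidefinite operator of unit trace on
`ℂ² ⊗ ℂ²` has exactly one negative eigenvalue and three positive eigenvalues
(with multiplicity). -/
theorem partialTranspose_of_entangled_two_qubit_signature
    (ρ : Matrix (Fin 2 × Fin 2) (Fin 2 × Fin 2) ℂ)
    (hρ : ρ.PosSemidef) (htr : ρ.trace = 1) (hent : ¬ IsSeparableState ρ) :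
    Module.finrank ℂ (negSpace (partialTranspose ρ)) = 1 ∧
    Module.finrank ℂ (posSpace (partialTranspose ρ)) = 3 := by
  have hW := hρ.isHermitian.partialTranspose
  have hle := card_eigenvalues_nonpos_le_one hρ hent hW
  have hneg : 0 < (Finset.univ.filter fun i => hW.eigenvalues i < 0).card := by
    rw [Finset.card_pos]
    by_contra h
    refine hent (isSeparableState_of_partialTranspose_posSemidef ρ hρ
      (hW.posSemidef_iff_eigenvalues_nonneg.2 fun i => ?_))
    by_contra hi
    exact h ⟨i, by simpa using hi⟩
  have hmono : (Finset.univ.filter fun i => hW.eigenvalues i < 0).card ≤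
      (Finset.univ.filter fun i => hW.eigenvalues i ≤ 0).card :=
    Finset.card_le_card (Finset.monotone_filter_right _ fun _ _ h => le_of_lt h)
  have hsum := Finset.card_filter_add_card_filter_not (s := Finset.univ)
    fun i => hW.eigenvalues i ≤ 0
  simp only [not_le, Finset.card_univ, Fintype.card_prod, Fintype.card_fin] at hsum
  rw [negSpace, posSpace, hW.finrank_iSup_eigenspace (· < 0), hW.finrank_iSup_eigenspace (0 < ·)]
  omega
end
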